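/- Under the standing hypotheses, there exist a group 𝒢 and an injective group homomorphism ι : G →* 𝒢 such that: (a) for any two distinct involutions r, s of 𝒢 the product r·s has infinite order; (b) for all involutions a, b, c, d of 𝒢 with a ≠ b and c ≠ d there is a unique g ∈ 𝒢 with g⁻¹·a·g = c and g⁻¹·b·g = d (that is, 𝒢 acts sharply 2-transitively by conjugation on its set of involutions, in characteristic 0); and (c) every abelian normal subgroup of 𝒢 is trivial. -/

import Mathlib

/-- An involution: an element of order 2. -/
def IsInvol {G : Type*} [Group G] (s : G) : Prop := orderOf s = 2

/-- `s₁ ∼_j s₂`: there are nonzero integers `m, n` with `(j·s₁)^m = (j·s₂)^n`. -/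
def JEquiv {G : Type*} [Group G] (j s₁ s₂ : G) : Prop :=
  ∃ m n : ℤ, m ≠ 0 ∧ n ≠ 0 ∧ (j * s₁) ^ m = (j * s₂) ^ n

/-- `s₁` is minimal relative to `j`: `⟨j, s₂⟩ ≤ ⟨j, s₁⟩` for every involution `s₂ ∼_j s₁`. -/
def JMinimal {G : Type*} [Group G] (j s₁ : G) : Prop :=
  ∀ s₂ : G, IsInvol s₂ → JEquiv j s₂ s₁ →
    Subgroup.closure ({j, s₂} : Set G) ≤ Subgroup.closure ({j, s₁} : Set G)

/-- The standing hypotheses (1)–(6) on `G`, `j`, `t`, `t'`. -/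
structure StandingHyp {G : Type*} [Group G] (j t t' : G) : Prop where
  invol_j : IsInvol j
  invol_t : IsInvol t
  invol_t' : IsInvol t'
  tconj : t' * j * t' = t
  all_conj : ∀ s₁ s₂ : G, IsInvol s₁ → IsInvol s₂ → IsConj s₁ s₂
  infinite_order : ∀ r s : G, IsInvol r → IsInvol s → r ≠ s → ¬ IsOfFinOrder (r * s)
  unique_root : ∀ n : ℕ, 0 < n → ∃! s : G, IsInvol s ∧ (j * s) ^ n = j * t
  conj_in_A : ∀ s : G, IsInvol s → JEquiv j s t →
      ∃ a ∈ Subgroup.centralizer ({j} : Set G), a⁻¹ * t * a = s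
  centralizer_eq : ∀ s : G, IsInvol s → s ≠ j → ∀ x : G,
      x ∈ Subgroup.centralizer ({j * s} : Set G) ↔
        x = 1 ∨ ∃ s' : G, IsInvol s' ∧ JEquiv j s' s ∧ x = j * s'
  unique_minimal : ∀ s : G, IsInvol s →
      ¬ (∃ a ∈ Subgroup.centralizer ({j} : Set G),
           ∃ b ∈ Subgroup.centralizer ({j} : Set G), s = a * t * b) →
      ∃! s' : G, IsInvol s' ∧ JEquiv j s' s ∧ JMinimal j s'

universe u

/-! ### Representatives of right cosets -/

open Classical in
/-- A representative of the right coset `H * g`, equal to `1` if `g ∈ H`. -/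
noncomputable def Subgroup.rightRep {G : Type*} [Group G] (H : Subgroup G) (g : G) : G :=
  if g ∈ H then 1 else (Quotient.mk (QuotientGroup.rightRel H) g).out

namespace Subgroup

variable {G : Type*} [Group G] (H : Subgroup G)

theorem mul_inv_rightRep_mem (g : G) : g * (H.rightRep g)⁻¹ ∈ H := by
  unfold rightRep
  split_ifs with h
  · simpa using h
  · have := Quotient.mk_out (s := QuotientGroup.rightRel H) g
    exact QuotientGroup.rightRel_apply.1 this

theorem rightRep_mul_of_mem {k : G} (hk : k ∈ H) (g : G) :
    H.rightRep (k * g) = H.rightRep g := by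
  unfold rightRep
  have h1 : k * g ∈ H ↔ g ∈ H := H.mul_mem_cancel_left hk
  have h2 : Quotient.mk (QuotientGroup.rightRel H) (k * g) =
      Quotient.mk (QuotientGroup.rightRel H) g := by
    apply Quotient.sound
    apply QuotientGroup.rightRel_apply.2
    simpa [mul_assoc] using hk
  by_cases h : g ∈ H
  · rw [if_pos h, if_pos (h1.2 h)]
  · rw [if_neg h, if_neg (mt h1.1 h), h2]

theorem rightRep_rightRep (g : G) : H.rightRep (H.rightRep g) = H.rightRep g := by
  have h := H.rightRep_mul_of_mem (H.inv_mem (H.mul_inv_rightRep_mem g)) g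
  simpa using h

end Subgroup

/-! ### Multiple HNN extensions -/

/-- Associated subgroups and isomorphisms for an HNN extension with several stable letters.
The set `L` of signed letters carries the formal inversion `bar`; the letter `l` conjugates the
subgroup `K l` to `K (bar l)` through `φ l`. -/
structure HNNData (G : Type u) [Group G] where
  /-- signed stable letters -/
  L : Type u
  /-- formal inversion of letters -/
  bar : L → L
  /-- the sign of a letter -/
  sgn : L → ℤ
  /-- associated subgroups -/
  K : L → Subgroup G
  /-- the isomorphism `K l ≃ K (bar l)`, with junk values outside `K l` -/
  φ : L → G → G
  bar_bar : ∀ l, bar (bar l) = l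
  sgn_odd : ∀ l, Odd (sgn l)
  sgn_bar : ∀ l, sgn (bar l) = -sgn l
  φ_mem : ∀ l k, k ∈ K l → φ l k ∈ K (bar l)
  φ_mul : ∀ l k k', k ∈ K l → k' ∈ K l → φ l (k * k') = φ l k * φ l k'
  φ_bar : ∀ l k, k ∈ K l → φ (bar l) (φ l k) = k

namespace HNNData

variable {G : Type u} [Group G] (d : HNNData G)

/-- Normal forms of right cosets of the base group. -/
def IsNormal (w : List (d.L × G)) : Prop :=
  w.IsChain (fun a b => ¬ (a.2 ∈ d.K a.1 ∧ b.1 = d.bar a.1)) ∧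
    ∀ a ∈ w, (d.K a.1).rightRep a.2 = a.2

/-- `l` cancels against the beginning of the word. -/
def Cancels (l : d.L) (w : G × List (d.L × G)) : Prop :=
  w.1 ∈ d.K l ∧ ∃ a v, w.2 = (d.bar l, a) :: v

/-- The result of prepending a letter that does not cancel. -/
noncomputable def push (l : d.L) (w : G × List (d.L × G)) : G × List (d.L × G) :=
  (d.φ l (w.1 * ((d.K l).rightRep w.1)⁻¹), (l, (d.K l).rightRep w.1) :: w.2)

/-- The result of prepending a letter that cancels. -/
def pop (l : d.L) (w : G × List (d.L × G)) : G × List (d.L × G) :=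
  (d.φ l w.1 * (w.2.head?.map Prod.snd).getD 1, w.2.tail)

open Classical in
/-- Left multiplication of a normal word by a letter. -/
noncomputable def step (l : d.L) (w : G × List (d.L × G)) : G × List (d.L × G) :=
  if d.Cancels l w then d.pop l w else d.push l w

variable {d}

theorem IsNormal.tail {a : d.L × G} {w : List (d.L × G)} (h : d.IsNormal (a :: w)) :
    d.IsNormal w :=
  ⟨(List.isChain_cons.1 h.1).2, fun b hb => h.2 b (List.mem_cons_of_mem _ hb)⟩

theorem step_of_cancels {l : d.L} {g a : G} {w : List (d.L × G)} (hg : g ∈ d.K l) :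
    d.step l (g, (d.bar l, a) :: w) = (d.φ l g * a, w) := by
  rw [step, if_pos ⟨hg, a, w, rfl⟩]
  simp [pop]

theorem step_of_not_cancels {l : d.L} {w : G × List (d.L × G)} (h : ¬ d.Cancels l w) :
    d.step l w = d.push l w := if_neg h

theorem isNormal_step (l : d.L) (w : G × List (d.L × G)) (hw : d.IsNormal w.2) :
    d.IsNormal (d.step l w).2 := by
  by_cases h : d.Cancels l w
  · obtain ⟨g, v⟩ := w
    obtain ⟨hg, a, w', rfl⟩ := h
    rw [step_of_cancels hg]
    exact hw.tail
  · rw [step_of_not_cancels h]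
    refine ⟨List.isChain_cons.2 ⟨?_, hw.1⟩, ?_⟩
    · rintro ⟨l', a⟩ hb ⟨h1, h2⟩
      apply h
      refine ⟨?_, ?_⟩
      · have := (d.K l).mul_mem ((d.K l).mul_inv_rightRep_mem w.1) h1
        simpa using this
      · dsimp only at h2
        subst h2
        exact ⟨a, w.2.tail, (List.cons_head?_tail hb).symm⟩
    · intro a ha
      rcases List.mem_cons.1 ha with rfl | ha
      · exact (d.K l).rightRep_rightRep _
      · exact hw.2 a ha

theorem step_bar_step (l : d.L) (w : G × List (d.L × G)) (hw : d.IsNormal w.2) :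
    d.step (d.bar l) (d.step l w) = w := by
  by_cases h : d.Cancels l w
  · obtain ⟨g, v⟩ := w
    obtain ⟨hg, a, w', rfl⟩ := h
    dsimp only at hg hw
    rw [step_of_cancels hg]
    have ha : (d.K (d.bar l)).rightRep a = a := hw.2 _ List.mem_cons_self
    rw [step_of_not_cancels]
    · simp [push, (d.K (d.bar l)).rightRep_mul_of_mem (d.φ_mem l g hg), ha, d.φ_bar l g hg]
    · rintro ⟨h1, b, w'', h2⟩
      dsimp only at h1 h2
      subst h2
      have := (List.isChain_cons.1 hw.1).1 (d.bar (d.bar l), b) (by simp)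
      exact this ⟨((d.K _).mul_mem_cancel_left (d.φ_mem l g hg)).1 h1, rfl⟩
  · rw [step_of_not_cancels h]
    have hk := (d.K l).mul_inv_rightRep_mem w.1
    have := step_of_cancels (d := d) (l := d.bar l) (a := (d.K l).rightRep w.1) (w := w.2)
      (d.φ_mem l _ hk)
    rw [d.bar_bar, d.φ_bar l _ hk] at this
    simpa [push] using this

theorem step_mul (l : d.L) {k : G} (hk : k ∈ d.K l) (w : G × List (d.L × G)) :
    d.step l (k * w.1, w.2) = (d.φ l k * (d.step l w).1, (d.step l w).2) := by
  by_cases h : d.Cancels l w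
  · obtain ⟨g, v⟩ := w
    obtain ⟨hg, a, w', rfl⟩ := h
    dsimp only at hg
    rw [step_of_cancels hg, step_of_cancels ((d.K l).mul_mem hk hg), d.φ_mul l k g hk hg, mul_assoc]
  · have h' : ¬ d.Cancels l (k * w.1, w.2) := fun hc =>
      h ⟨((d.K l).mul_mem_cancel_left hk).1 hc.1, hc.2⟩
    rw [step_of_not_cancels h, step_of_not_cancels h']
    simp only [push, (d.K l).rightRep_mul_of_mem hk]
    rw [mul_assoc, d.φ_mul l _ _ hk ((d.K l).mul_inv_rightRep_mem w.1)]

variable (d)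

/-- Normal words: an element of the base group followed by the normal form of a coset. -/
abbrev NormalWord : Type u := {w : G × List (d.L × G) // d.IsNormal w.2}

/-- The base group acts on normal words. -/
def basePerm : G →* Equiv.Perm d.NormalWord where
  toFun g :=
    { toFun := fun w => ⟨(g * w.1.1, w.1.2), w.2⟩
      invFun := fun w => ⟨(g⁻¹ * w.1.1, w.1.2), w.2⟩
      left_inv := fun w => by simp
      right_inv := fun w => by simp }
  map_one' := by ext w <;> simp
  map_mul' g h := by ext w <;> simp [mul_assoc]

/-- Stable letters act on normal words. -/
noncomputable def letterPerm (l : d.L) : Equiv.Perm d.NormalWord where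
  toFun w := ⟨d.step l w.1, isNormal_step l w.1 w.2⟩
  invFun w := ⟨d.step (d.bar l) w.1, isNormal_step _ w.1 w.2⟩
  left_inv w := Subtype.ext (step_bar_step l w.1 w.2)
  right_inv w := Subtype.ext (by
    have := step_bar_step (d.bar l) w.1 w.2
    rwa [d.bar_bar] at this)

theorem letterPerm_bar (l : d.L) : d.letterPerm (d.bar l) = (d.letterPerm l)⁻¹ :=
  eq_inv_of_mul_eq_one_left (Equiv.ext fun w => Subtype.ext (step_bar_step l w.1 w.2))

theorem letterPerm_mul_basePerm (l : d.L) {k : G} (hk : k ∈ d.K l) :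
    d.letterPerm l * d.basePerm k = d.basePerm (d.φ l k) * d.letterPerm l := by
  apply Equiv.ext
  intro w
  exact Subtype.ext (step_mul l hk w.1)

/-- The multiple HNN extension, realised as a permutation group of normal words. -/
def extension : Subgroup (Equiv.Perm d.NormalWord) :=
  Subgroup.closure (Set.range d.basePerm ∪ Set.range d.letterPerm)

/-- The permutation spelled by a normal word. -/
noncomputable def spell (w : G × List (d.L × G)) : Equiv.Perm d.NormalWord :=
  d.basePerm w.1 * (w.2.map fun a => d.letterPerm a.1 * d.basePerm a.2).prod

theorem spell_step (l : d.L) (w : G × List (d.L × G)) :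
    d.spell (d.step l w) = d.letterPerm l * d.spell w := by
  by_cases h : d.Cancels l w
  · obtain ⟨g, v⟩ := w
    obtain ⟨hg, a, w', rfl⟩ := h
    dsimp only at hg
    rw [step_of_cancels hg]
    simp only [spell, List.map_cons, List.prod_cons, ← mul_assoc, map_mul]
    rw [letterPerm_mul_basePerm d l hg, letterPerm_bar]
    group
  · rw [step_of_not_cancels h]
    have hk := (d.K l).mul_inv_rightRep_mem w.1
    simp only [spell, push, List.map_cons, List.prod_cons, ← mul_assoc]
    rw [← letterPerm_mul_basePerm d l hk]
    simp [mul_assoc]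

theorem spell_apply {x : Equiv.Perm d.NormalWord} (hx : x ∈ d.extension) (w : d.NormalWord) :
    d.spell (x w).1 = x * d.spell w.1 := by
  induction hx using Subgroup.closure_induction generalizing w with
  | mem x hx =>
    rcases hx with ⟨g, rfl⟩ | ⟨l, rfl⟩
    · change d.basePerm (g * w.1.1) * _ = d.basePerm g * (d.basePerm w.1.1 * _)
      rw [map_mul, mul_assoc]
      rfl
    · exact d.spell_step l w.1
  | one => simp
  | mul x y _ _ hx hy => rw [Equiv.Perm.mul_apply, hx, hy, mul_assoc]
  | inv x _ hx =>
    have := hx (x⁻¹ w)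
    have hw : x (x⁻¹ w) = w := x.apply_symm_apply w
    rw [hw] at this
    rw [this, inv_mul_cancel_left]

/-- The inclusion of the base group. -/
def of : G →* d.extension :=
  d.basePerm.codRestrict _ fun g => Subgroup.subset_closure (Or.inl ⟨g, rfl⟩)

/-- The stable letters. -/
noncomputable def letter (l : d.L) : d.extension :=
  ⟨d.letterPerm l, Subgroup.subset_closure (Or.inr ⟨l, rfl⟩)⟩

/-- The empty normal word. -/
def emptyWord : d.NormalWord := ⟨(1, []), List.isChain_nil, by simp⟩

/-- The length of the normal form. -/
def len (x : d.extension) : ℕ := (x.1 d.emptyWord).1.2.length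

/-- The sum of the signs of the letters of a normal word. -/
def signSum (w : G × List (d.L × G)) : ℤ := (w.2.map fun a => d.sgn a.1).sum

theorem spell_emptyWord : d.spell d.emptyWord.1 = 1 := by
  simp [spell, emptyWord]

theorem spell_apply_emptyWord (x : d.extension) : d.spell (x.1 d.emptyWord).1 = x.1 := by
  rw [d.spell_apply x.2, spell_emptyWord, mul_one]

theorem of_apply (g : G) (w : d.NormalWord) : ((d.of g).1 w).1 = (g * w.1.1, w.1.2) := rfl

theorem of_injective : Function.Injective d.of := by
  intro g h hgh
  have := congrArg (fun x : d.extension => (x.1 d.emptyWord).1.1) hgh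
  simpa [of_apply, emptyWord] using this

theorem letter_bar (l : d.L) : d.letter (d.bar l) = (d.letter l)⁻¹ :=
  Subtype.ext (d.letterPerm_bar l)

theorem letter_mul_of (l : d.L) {k : G} (hk : k ∈ d.K l) :
    d.letter l * d.of k = d.of (d.φ l k) * d.letter l :=
  Subtype.ext (d.letterPerm_mul_basePerm l hk)

theorem len_eq_zero_iff {x : d.extension} : d.len x = 0 ↔ ∃ g, d.of g = x := by
  constructor
  · intro h
    refine ⟨(x.1 d.emptyWord).1.1, Subtype.ext ?_⟩
    have h' : (x.1 d.emptyWord).1.2 = [] := List.length_eq_zero_iff.1 h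
    refine Eq.trans ?_ (d.spell_apply_emptyWord x)
    change d.basePerm _ = d.basePerm _ * _
    simp [h']
  · rintro ⟨g, rfl⟩
    simp [len, of_apply, emptyWord]

theorem len_of_mul (g : G) (x : d.extension) : d.len (d.of g * x) = d.len x := rfl

theorem len_letter_mul_of_cancels {l : d.L} {x : d.extension}
    (h : d.Cancels l (x.1 d.emptyWord).1) : d.len (d.letter l * x) + 1 = d.len x := by
  have h1 : d.len (d.letter l * x) = (d.step l (x.1 d.emptyWord).1).2.length := rfl
  obtain ⟨_, a, w', h2⟩ := id h
  rw [h1, step, if_pos h, len, h2]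
  simp [pop, h2]

theorem len_letter_mul_of_not_cancels {l : d.L} {x : d.extension}
    (h : ¬ d.Cancels l (x.1 d.emptyWord).1) : d.len (d.letter l * x) = d.len x + 1 := by
  have h1 : d.len (d.letter l * x) = (d.step l (x.1 d.emptyWord).1).2.length := rfl
  rw [h1, step_of_not_cancels h, len]
  simp [push]

theorem len_letter_mul (l : d.L) (x : d.extension) :
    d.len (d.letter l * x) = d.len x + 1 ∨ d.len (d.letter l * x) + 1 = d.len x := by
  by_cases h : d.Cancels l (x.1 d.emptyWord).1
  · exact Or.inr (d.len_letter_mul_of_cancels h)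
  · exact Or.inl (d.len_letter_mul_of_not_cancels h)

theorem exists_len_letter_mul {x : d.extension} (hx : d.len x ≠ 0) :
    ∃ l g, d.len (d.letter l * (d.of g * x)) + 1 = d.len x := by
  obtain ⟨⟨l, a⟩, w', hw⟩ := List.exists_cons_of_length_pos (Nat.pos_of_ne_zero hx)
  refine ⟨d.bar l, (x.1 d.emptyWord).1.1⁻¹, ?_⟩
  rw [d.len_letter_mul_of_cancels, len_of_mul]
  refine ⟨?_, a, w', ?_⟩
  · change _⁻¹ * (x.1 d.emptyWord).1.1 ∈ _
    simp [one_mem]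
  · rw [d.bar_bar]
    exact hw

theorem eq_and_mem_of_len_letter_mul_lt {l l' : d.L} {g : G} {x : d.extension}
    (h : d.len (d.letter l * x) < d.len x) (h' : d.len (d.letter l' * (d.of g * x)) < d.len x) :
    l = l' ∧ g ∈ d.K l := by
  have hc : d.Cancels l (x.1 d.emptyWord).1 := by
    by_contra hc
    have := d.len_letter_mul_of_not_cancels hc
    omega
  have hc' : d.Cancels l' ((d.of g * x).1 d.emptyWord).1 := by
    by_contra hc
    have := d.len_letter_mul_of_not_cancels hc
    rw [len_of_mul] at this
    omega
  obtain ⟨h1, a, w, h2⟩ := hc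
  obtain ⟨h1', a', w', h2'⟩ := hc'
  have h3 : (x.1 d.emptyWord).1.2 = (d.bar l', a') :: w' := h2'
  rw [h2] at h3
  have h4 : d.bar l = d.bar l' := by
    simp only [List.cons.injEq, Prod.mk.injEq] at h3
    exact h3.1.1
  have h5 : l = l' := by rw [← d.bar_bar l, h4, d.bar_bar]
  subst h5
  have h6 : g * (x.1 d.emptyWord).1.1 ∈ d.K l := h1'
  exact ⟨rfl, ((d.K l).mul_mem_cancel_right h1).1 h6⟩

theorem signSum_step (l : d.L) (w : G × List (d.L × G)) :
    d.signSum (d.step l w) = d.signSum w + d.sgn l := by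
  by_cases h : d.Cancels l w
  · obtain ⟨g, v⟩ := w
    obtain ⟨hg, a, w', rfl⟩ := h
    dsimp only at hg
    rw [step_of_cancels hg]
    simp [signSum, d.sgn_bar]
  · rw [step_of_not_cancels h]
    simp [signSum, push, add_comm]

theorem exists_signSum_apply {x : Equiv.Perm d.NormalWord} (hx : x ∈ d.extension) :
    ∃ c, ∀ w : d.NormalWord, d.signSum (x w).1 = d.signSum w.1 + c := by
  induction hx using Subgroup.closure_induction with
  | mem x hx =>
    rcases hx with ⟨g, rfl⟩ | ⟨l, rfl⟩
    · exact ⟨0, fun w => by simp [signSum, basePerm]⟩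
    · exact ⟨d.sgn l, fun w => d.signSum_step l w.1⟩
  | one => exact ⟨0, fun w => by simp⟩
  | mul x y _ _ hx hy =>
    obtain ⟨a, ha⟩ := hx
    obtain ⟨b, hb⟩ := hy
    exact ⟨a + b, fun w => by rw [Equiv.Perm.mul_apply, ha, hb]; ring⟩
  | inv x _ hx =>
    obtain ⟨a, ha⟩ := hx
    refine ⟨-a, fun w => ?_⟩
    have := ha (x⁻¹ w)
    have hw : x (x⁻¹ w) = w := x.apply_symm_apply w
    rw [hw] at this
    linarith

/-- The total exponent of the stable letters. -/
def exponentSum (x : d.extension) : ℤ := d.signSum (x.1 d.emptyWord).1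

theorem exponentSum_mul (x y : d.extension) :
    d.exponentSum (x * y) = d.exponentSum x + d.exponentSum y := by
  obtain ⟨c, hc⟩ := d.exists_signSum_apply x.2
  have h1 := hc d.emptyWord
  have h2 : d.signSum ((x * y).1 d.emptyWord).1 = d.signSum (y.1 d.emptyWord).1 + c := hc _
  have h3 : d.signSum d.emptyWord.1 = 0 := by simp [signSum, emptyWord]
  simp only [exponentSum]
  linarith

theorem even_len_iff (x : d.extension) : Even (d.len x) ↔ Even (d.exponentSum x) := by
  unfold len exponentSum signSum
  induction (x.1 d.emptyWord).1.2 with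
  | nil => simp
  | cons a w ih =>
    have := d.sgn_odd a.1
    simp only [List.length_cons, List.map_cons, List.sum_cons]
    rw [Nat.even_add_one, Int.even_add, ← ih, ← Int.not_odd_iff_even]
    tauto

end HNNData

/-! ### Tree metrics -/

/-- The combinatorial characterisation of the path metric on the vertices of a tree. -/
structure IsTreeDist {V : Type*} (d : V → V → ℕ) : Prop where
  self : ∀ x, d x x = 0
  comm : ∀ x y, d x y = d y x
  triangle : ∀ x y z, d x z ≤ d x y + d y z
  neighbour : ∀ x x' y, d x x' = 1 → d y x' = d y x + 1 ∨ d y x' + 1 = d y x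
  exists_closer : ∀ x y, d y x ≠ 0 → ∃ x', d x x' = 1 ∧ d y x' + 1 = d y x
  closer_unique : ∀ x y x' x'', d x x' = 1 → d x x'' = 1 → d y x' + 1 = d y x →
    d y x'' + 1 = d y x → d x' x'' = 0

namespace IsTreeDist

variable {V : Type*} {d : V → V → ℕ}

theorem dist_eq_add_of_separates (h : IsTreeDist d) {n : ℕ} :
    ∀ {x x' y z : V}, d x x' = 1 → d y x = n →
    d y x' + 1 = d y x → d z x' = d z x + 1 → d y z = d y x + d x z := by
  induction n with
  | zero => intro x x' y z _ h1 h2 _; omega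
  | succ n ih =>
    intro x x' y z hx hn hy hz
    have c1 := h.comm z x
    have c2 := h.comm z x'
    by_cases h0 : d y x' = 0
    · have t1 := h.triangle y x' z
      have t2 := h.triangle x' y z
      have c3 := h.comm x' y
      omega
    · obtain ⟨x'', hx'', hy''⟩ := h.exists_closer x' y h0
      have hx' : d x' x = 1 := (h.comm _ _).trans hx
      rcases h.neighbour x' x'' z hx'' with hz'' | hz''
      · have := ih hx'' (by omega) hy'' hz''
        omega
      · have h1 := h.closer_unique x' z x x'' hx' hx'' (by omega) hz''
        have t1 := h.triangle y x'' x
        have c3 := h.comm x'' x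
        omega

theorem four_point (h : IsTreeDist d) (x y z u : V) :
    d x y + d z u ≤ max (d x z + d y u) (d x u + d y z) := by
  induction hn : d x y generalizing x with
  | zero =>
    have t1 := h.triangle z x u
    have t2 := h.triangle x y u
    have c1 := h.comm z x
    omega
  | succ n ih =>
    have cxy := h.comm x y
    obtain ⟨x', hx, hy⟩ := h.exists_closer x y (by omega)
    have c1 := h.comm x z
    have c2 := h.comm x' z
    have c3 := h.comm x u
    have c4 := h.comm x' u
    have c5 := h.comm x' y
    have t1 := h.triangle z x u
    rcases h.neighbour x x' z hx with hz | hz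
    · have := h.dist_eq_add_of_separates hx rfl hy hz
      omega
    · rcases h.neighbour x x' u hx with hu | hu
      · have := h.dist_eq_add_of_separates hx rfl hy hu
        omega
      · have := ih x' (by omega)
        omega

end IsTreeDist

/-- Actions on the vertices of a tree by automorphisms for which no element of order two
inverts an edge. -/
structure IsTreeAction (Γ : Type*) [Group Γ] {V : Type*} [MulAction Γ V] (d : V → V → ℕ) :
    Prop where
  self : ∀ x, d x x = 0
  comm : ∀ x y, d x y = d y x
  four_point : ∀ x y z u, d x y + d z u ≤ max (d x z + d y u) (d x u + d y z)
  smul : ∀ (g : Γ) x y, d (g • x) (g • y) = d x y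
  geodesic : ∀ x y n, n ≤ d x y → ∃ z, d x z = n ∧ d z y + n = d x y
  even_of_sq : ∀ (r : Γ) x, r * r = 1 → Even (d x (r • x))

/-- Displacement functions of actions on trees at a vertex. -/
structure IsTreeLength {Γ : Type*} [Group Γ] (len : Γ → ℕ) : Prop where
  one : len 1 = 0
  inv : ∀ x, len x⁻¹ = len x
  four_point : ∀ x y z u, len (x⁻¹ * y) + len (z⁻¹ * u) ≤
    max (len (x⁻¹ * z) + len (y⁻¹ * u)) (len (x⁻¹ * u) + len (y⁻¹ * z))

theorem IsTreeAction.isTreeLength {Γ : Type*} [Group Γ] {V : Type*} [MulAction Γ V]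
    {d : V → V → ℕ} (h : IsTreeAction Γ d) (v : V) : IsTreeLength fun g : Γ => d v (g • v) := by
  have e : ∀ x y : Γ, d v ((x⁻¹ * y) • v) = d (x • v) (y • v) := fun x y => by
    rw [mul_smul, ← h.smul x, smul_inv_smul]
  exact
    { one := by simp [h.self]
      inv := fun x => by
        have := e x 1
        rw [mul_one, one_smul] at this
        rw [this, h.comm]
      four_point := fun x y z u => by
        simp only [e]
        exact h.four_point _ _ _ _ }

namespace HNNData

variable {G : Type u} [Group G] (d : HNNData G)

theorem len_one : d.len 1 = 0 := d.len_eq_zero_iff.2 ⟨1, map_one _⟩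

theorem exists_eq_of_mul_letter_mul {x : d.extension} (hx : d.len x ≠ 0) :
    ∃ g l y, x = d.of g * (d.letter l * y) ∧ d.len y + 1 = d.len x := by
  obtain ⟨l, g, h⟩ := d.exists_len_letter_mul hx
  refine ⟨g⁻¹, d.bar l, _, ?_, h⟩
  simp [letter_bar]

theorem len_mul_le (x y : d.extension) : d.len (x * y) ≤ d.len x + d.len y := by
  induction hn : d.len x generalizing x with
  | zero =>
    obtain ⟨g, rfl⟩ := d.len_eq_zero_iff.1 hn
    simp [len_of_mul]
  | succ n ih =>
    obtain ⟨g, l, x', rfl, hx⟩ := d.exists_eq_of_mul_letter_mul (x := x) (by omega)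
    have h1 := ih x' (by omega)
    have h2 := d.len_letter_mul l (x' * y)
    rw [mul_assoc, mul_assoc, len_of_mul]
    omega

theorem len_letter_mul_of (l : d.L) (g : G) : d.len (d.letter l * d.of g) = 1 := by
  have h1 := d.len_letter_mul l (d.of g)
  have h2 := d.len_eq_zero_iff.2 ⟨g, rfl⟩
  omega

theorem len_inv_le (x : d.extension) : d.len x⁻¹ ≤ d.len x := by
  induction hn : d.len x generalizing x with
  | zero =>
    obtain ⟨g, rfl⟩ := d.len_eq_zero_iff.1 hn
    rw [← map_inv, d.len_eq_zero_iff.2 ⟨_, rfl⟩]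
  | succ n ih =>
    obtain ⟨g, l, x', rfl, hx⟩ := d.exists_eq_of_mul_letter_mul (x := x) (by omega)
    have h1 := ih x' (by omega)
    have h2 := d.len_mul_le x'⁻¹ (d.letter (d.bar l) * d.of g⁻¹)
    rw [len_letter_mul_of] at h2
    rw [letter_bar, map_inv, ← mul_inv_rev, ← mul_inv_rev, mul_assoc] at h2
    omega

theorem len_inv (x : d.extension) : d.len x⁻¹ = d.len x :=
  le_antisymm (d.len_inv_le x) (by simpa using d.len_inv_le x⁻¹)

theorem exists_eq_of_len_eq_one {x : d.extension} (hx : d.len x = 1) :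
    ∃ g l g', x = d.of g * (d.letter l * d.of g') := by
  obtain ⟨g, l, y, rfl, hy⟩ := d.exists_eq_of_mul_letter_mul (x := x) (by omega)
  obtain ⟨g', rfl⟩ := (d.len_eq_zero_iff (x := y)).1 (by omega)
  exact ⟨g, l, g', rfl⟩

theorem isTreeDist : IsTreeDist fun x y : d.extension => d.len (x * y⁻¹) where
  self x := by simp [len_one]
  comm x y := by rw [← len_inv]; simp
  triangle x y z := by
    have := d.len_mul_le (x * y⁻¹) (y * z⁻¹)
    simpa using this
  neighbour x x' y hx := by
    rw [← len_inv] at hx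
    obtain ⟨g, l, g', h⟩ := d.exists_eq_of_len_eq_one hx
    have h1 := d.len_letter_mul l (d.of g' * (x * y⁻¹))
    have h2 : d.len (y * x'⁻¹) = d.len (d.letter l * (d.of g' * (x * y⁻¹))) := by
      rw [← len_inv, ← d.len_of_mul g (d.letter l * _)]
      congr 1
      have e : x' = (x * x'⁻¹)⁻¹ * x := by group
      rw [mul_inv_rev, inv_inv, e, h]
      group
    have h3 : d.len (y * x⁻¹) = d.len (d.of g' * (x * y⁻¹)) := by
      rw [← len_inv, len_of_mul]
      simp
    omega
  exists_closer x y hx := by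
    rw [← len_inv] at hx
    obtain ⟨l, g, h⟩ := d.exists_len_letter_mul hx
    refine ⟨d.letter l * (d.of g * x), ?_, ?_⟩
    · rw [← len_inv]
      have := d.len_letter_mul_of l g
      simpa [mul_assoc] using this
    · rw [← len_inv, ← d.len_inv (y * x⁻¹)]
      simpa [mul_assoc] using h
  closer_unique x y x' x'' hx' hx'' hy' hy'' := by
    rw [← len_inv] at hx' hx''
    obtain ⟨a, l, b, h⟩ := d.exists_eq_of_len_eq_one hx'
    obtain ⟨a', l', b', h'⟩ := d.exists_eq_of_len_eq_one hx''
    have e : x' = d.of a * (d.letter l * (d.of b * x)) := by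
      have : x' = (x * x'⁻¹)⁻¹ * x := by group
      rw [this, h]; group
    have e' : x'' = d.of a' * (d.letter l' * (d.of b' * x)) := by
      have : x'' = (x * x''⁻¹)⁻¹ * x := by group
      rw [this, h']; group
    rw [← len_inv, ← d.len_inv (y * x⁻¹)] at hy' hy''
    have h1 : d.len (d.letter l * (d.of b * x * y⁻¹)) < d.len (d.of b * x * y⁻¹) := by
      have e1 : x' * y⁻¹ = d.of a * (d.letter l * (d.of b * x * y⁻¹)) := by
        rw [e]; group
      rw [mul_inv_rev, inv_inv, e1, len_of_mul] at hy'
      rw [mul_inv_rev, inv_inv] at hy'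
      rw [mul_assoc (d.of b), len_of_mul d b]
      rw [mul_assoc (d.of b)] at hy'
      omega
    have h2 : d.len (d.letter l' * (d.of (b' * b⁻¹) * (d.of b * x * y⁻¹))) <
        d.len (d.of b * x * y⁻¹) := by
      have e1 : x'' * y⁻¹ =
          d.of a' * (d.letter l' * (d.of (b' * b⁻¹) * (d.of b * x * y⁻¹))) := by
        rw [e', map_mul, map_inv]; group
      rw [mul_inv_rev, inv_inv, e1, len_of_mul, mul_inv_rev, inv_inv] at hy''
      have e2 : d.len (d.of b * x * y⁻¹) = d.len (x * y⁻¹) := by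
        rw [mul_assoc, len_of_mul]
      omega
    obtain ⟨rfl, h3⟩ := d.eq_and_mem_of_len_letter_mul_lt h1 h2
    apply d.len_eq_zero_iff.2
    refine ⟨(a' * d.φ l (b' * b⁻¹) * a⁻¹)⁻¹, ?_⟩
    have h4 := d.letter_mul_of l h3
    have h5 : d.of (d.φ l (b' * b⁻¹)) = d.letter l * d.of (b' * b⁻¹) * (d.letter l)⁻¹ := by
      rw [h4, mul_inv_cancel_right]
    rw [e, e']
    simp only [map_mul, map_inv] at h5 ⊢
    rw [h5]
    group

theorem exists_mul_of_le_len (x : d.extension) {n : ℕ} (hn : n ≤ d.len x) :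
    ∃ y z, x = y * z ∧ d.len y = n ∧ d.len z + n = d.len x := by
  induction n with
  | zero => exact ⟨1, x, by simp, d.len_one, rfl⟩
  | succ n ih =>
    obtain ⟨y, z, rfl, hy, hz⟩ := ih (by omega)
    obtain ⟨g, l, z', rfl, hz'⟩ := d.exists_eq_of_mul_letter_mul (x := z) (by omega)
    have e : y * (d.of g * (d.letter l * z')) = y * (d.of g * (d.letter l * d.of 1)) * z' := by
      simp [mul_assoc]
    have h1 := d.len_mul_le y (d.of g * (d.letter l * d.of 1))
    have h2 := d.len_mul_le (y * (d.of g * (d.letter l * d.of 1))) z'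
    rw [len_of_mul, len_letter_mul_of] at h1
    rw [← e] at h2
    exact ⟨_, z', e, by omega, by omega⟩

theorem even_len_of_sq {x : d.extension} (hx : x * x = 1) : Even (d.len x) := by
  rw [even_len_iff]
  have h1 := d.exponentSum_mul x x
  have h2 := d.exponentSum_mul 1 1
  rw [hx] at h1
  rw [mul_one] at h2
  have h3 : d.exponentSum x = 0 := by omega
  rw [h3]
  exact Even.zero

theorem isTreeAction : IsTreeAction d.extension fun x y : d.extension => d.len (x⁻¹ * y) where
  self x := by simp [len_one]
  comm x y := by
    rw [← len_inv]
    simp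
  four_point x y z u := by
    have := d.isTreeDist.four_point x⁻¹ y⁻¹ z⁻¹ u⁻¹
    simpa using this
  smul g x y := by
    rw [smul_eq_mul, smul_eq_mul]
    congr 1
    group
  geodesic x y n hn := by
    obtain ⟨a, b, h, ha, hb⟩ := d.exists_mul_of_le_len (x⁻¹ * y) hn
    refine ⟨x * a, by simpa using ha, ?_⟩
    rw [← hb, mul_inv_rev, mul_assoc, h, inv_mul_cancel_left]
  even_of_sq r x hr := d.even_len_of_sq (by
    rw [smul_eq_mul]
    calc x⁻¹ * (r * x) * (x⁻¹ * (r * x)) = x⁻¹ * (r * r) * x := by group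
      _ = 1 := by rw [hr]; group)

end HNNData

namespace IsTreeAction

variable {Γ : Type*} [Group Γ] {V : Type*} [MulAction Γ V] {d : V → V → ℕ}

theorem triangle (h : IsTreeAction Γ d) (x y z : V) : d x z ≤ d x y + d y z := by
  have h1 := h.four_point x z y y
  have h2 := h.comm z y
  have h3 := h.self y
  omega

theorem dist_smul_left (h : IsTreeAction Γ d) {r : Γ} {x : V} (hr : d x (r • x) = 0) (y : V) :
    d x (r • y) = d x y := by
  have h1 := h.triangle x (r • x) (r • y)
  have h2 := h.triangle (r • x) x (r • y)
  have h3 := h.smul r x y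
  have h4 := h.comm x (r • x)
  omega

/-- An element of order two fixes the midpoint of a vertex and its image. -/
theorem exists_fixed (h : IsTreeAction Γ d) {r : Γ} (hr : r * r = 1) (y : V) :
    ∃ m, d m (r • m) = 0 ∧ 2 * d y m = d y (r • y) := by
  obtain ⟨k, hk⟩ := h.even_of_sq r y hr
  obtain ⟨m, h1, h2⟩ := h.geodesic y (r • y) k (by omega)
  have h3 : d y (r • m) = d m (r • y) := by
    rw [← h.smul r, ← mul_smul, hr, one_smul, h.comm]
  refine ⟨m, ?_, by omega⟩
  have h5 := h.four_point m (r • m) y (r • y)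
  have h6 := h.smul r m y
  have h7 := h.comm m y
  have h8 := h.comm (r • m) y
  omega

theorem dist_of_local_geodesic (h : IsTreeAction Γ d) {p : ℕ → V} {n : ℕ} (hn : 0 < n)
    (h1 : ∀ i, d (p i) (p (i + 1)) = n)
    (h2 : ∀ i, d (p i) (p (i + 2)) = 2 * n) (k : ℕ) : d (p 0) (p k) = k * n := by
  suffices ∀ k, d (p 0) (p k) = k * n ∧ d (p 0) (p (k + 1)) = (k + 1) * n from
    (this k).1
  intro k
  induction k with
  | zero => exact ⟨by simp [h.self], by simpa using h1 0⟩
  | succ k ih =>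
    refine ⟨ih.2, ?_⟩
    have h3 := h.four_point (p 0) (p (k + 1)) (p k) (p (k + 2))
    have h4 := h.comm (p (k + 1)) (p k)
    have h5 := h.triangle (p 0) (p (k + 1)) (p (k + 2))
    have h6 := h1 k
    have h7 : d (p (k + 1)) (p (k + 2)) = n := h1 (k + 1)
    have h8 := h2 k
    have h9 := ih.1
    have h10 := ih.2
    have h11 : (k + 1) * n = k * n + n := by ring
    have h12 : (k + 1 + 1) * n = k * n + 2 * n := by ring
    change d (p 0) (p (k + 2)) = _
    omega

/-- Two elements of order two either fix a common vertex, or their product translates along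
an axis through a vertex fixed by the first one. -/
theorem elliptic_or_hyperbolic (h : IsTreeAction Γ d) {r s : Γ} (hr : r * r = 1)
    (hs : s * s = 1) (v : V) :
    (∃ x, d x (r • x) = 0 ∧ d x (s • x) = 0) ∨
      ∃ x n, 0 < n ∧ d x (r • x) = 0 ∧
        ∀ k : ℕ, d x ((r * s) ^ k • x) = 2 * n * k := by
  classical
  have hex : ∃ n x y, d x (r • x) = 0 ∧ d y (s • y) = 0 ∧ d x y = n := by
    obtain ⟨x, hx, -⟩ := h.exists_fixed hr v
    obtain ⟨y, hy, -⟩ := h.exists_fixed hs v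
    exact ⟨_, x, y, hx, hy, rfl⟩
  obtain ⟨x, y, hx, hy, hxy⟩ := Nat.find_spec hex
  have hmin : ∀ x y, d x (r • x) = 0 → d y (s • y) = 0 →
      Nat.find hex ≤ d x y := fun x y hx hy => Nat.find_min' hex ⟨x, y, hx, hy, rfl⟩
  set n := Nat.find hex
  rcases Nat.eq_zero_or_pos n with hn | hn
  · left
    refine ⟨x, hx, ?_⟩
    have h1 := h.triangle x y (s • x)
    have h2 := h.dist_smul_left hy x
    have h3 := h.comm y x
    omega
  · right
    refine ⟨x, n, hn, hx, ?_⟩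
    have hyr : d y (r • y) = 2 * n := by
      obtain ⟨m, hm, hm'⟩ := h.exists_fixed hr y
      have h1 := hmin m y hm hy
      have h2 := h.comm m y
      have h3 := h.triangle y x (r • y)
      have h4 := h.dist_smul_left hx y
      have h5 := h.comm x y
      omega
    have hxs : d x (s • x) = 2 * n := by
      obtain ⟨m, hm, hm'⟩ := h.exists_fixed hs x
      have h1 := hmin x m hx hm
      have h3 := h.triangle x y (s • x)
      have h4 := h.dist_smul_left hy x
      have h5 := h.comm x y
      omega
    let p : ℕ → V := fun i => if Even i then (r * s) ^ (i / 2) • x else (r * s) ^ (i / 2) • r • y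
    have pe : ∀ k, p (2 * k) = (r * s) ^ k • x := fun k => by simp [p]
    have po : ∀ k, p (2 * k + 1) = (r * s) ^ k • r • y := fun k => by
      have : (2 * k + 1) / 2 = k := by omega
      simp [p, this]
    have pe' : ∀ k, p (2 * k + 2) = (r * s) ^ k • r • s • x := fun k => by
      rw [show 2 * k + 2 = 2 * (k + 1) by ring, pe, pow_succ, mul_smul, mul_smul]
    have po' : ∀ k, p (2 * k + 3) = (r * s) ^ k • r • s • r • y := fun k => by
      rw [show 2 * k + 3 = 2 * (k + 1) + 1 by ring, po, pow_succ, mul_smul, mul_smul]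
    intro k
    have key := h.dist_of_local_geodesic (p := p) hn ?_ ?_ (2 * k)
    · rw [pe, show p 0 = x by simpa using pe 0] at key
      exact key.trans (by ring)
    · intro i
      obtain ⟨k, rfl | rfl⟩ := Nat.even_or_odd' i
      · rw [pe, po, h.smul, h.dist_smul_left hx, hxy]
      · change d (p (2 * k + 1)) (p (2 * k + 2)) = n
        rw [po, pe', h.smul, h.smul, h.dist_smul_left hy, h.comm, hxy]
    · intro i
      obtain ⟨k, rfl | rfl⟩ := Nat.even_or_odd' i
      · rw [pe, pe', h.smul, h.dist_smul_left hx, hxs]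
      · change d (p (2 * k + 1)) (p (2 * k + 3)) = 2 * n
        rw [po, po', h.smul, h.smul, h.dist_smul_left hy, hyr]

end IsTreeAction

namespace IsTreeLength

variable {Γ : Type*} [Group Γ] {len : Γ → ℕ}

/-- The distance between the translates of the base vertex by two group elements. -/
def dist (len : Γ → ℕ) (x y : Γ) : ℕ := len (x⁻¹ * y)

theorem dist_mul_left (g x y : Γ) : dist len (g * x) (g * y) = dist len x y := by
  unfold dist
  congr 1
  group

theorem dist_self (h : IsTreeLength len) (x : Γ) : dist len x x = 0 := by
  simp [dist, h.one]

theorem dist_comm (h : IsTreeLength len) (x y : Γ) : dist len x y = dist len y x := by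
  unfold dist
  rw [← h.inv]
  simp

theorem four_point_dist (h : IsTreeLength len) (x y z u : Γ) :
    dist len x y + dist len z u ≤
      max (dist len x z + dist len y u) (dist len x u + dist len y z) :=
  h.four_point x y z u

theorem dist_triangle (h : IsTreeLength len) (x y z : Γ) :
    dist len x z ≤ dist len x y + dist len y z := by
  have h1 := h.four_point_dist x z y y
  have h2 := h.dist_comm z y
  have h3 := h.dist_self y
  omega

/-- The elements commuting with a nontrivial power of `c`. -/
def commensurator (c : Γ) : Subgroup Γ where
  carrier := {g | ∃ m : ℕ, 0 < m ∧ Commute g (c ^ m)}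
  one_mem' := ⟨1, one_pos, Commute.one_left _⟩
  mul_mem' := by
    rintro g g' ⟨m, hm, h⟩ ⟨m', hm', h'⟩
    refine ⟨m * m', Nat.mul_pos hm hm', Commute.mul_left ?_ ?_⟩
    · rw [pow_mul]
      exact h.pow_right m'
    · rw [mul_comm, pow_mul]
      exact h'.pow_right m
  inv_mem' := by
    rintro g ⟨m, hm, h⟩
    exact ⟨m, hm, h.inv_left⟩

theorem exists_busemann (h : IsTreeLength len) {c : Γ} {a : ℕ}
    (hc : ∀ k : ℕ, len (c ^ k) = a * k) (g : Γ) :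
    ∃ (t : ℤ) (N₀ : ℕ), ∀ N ≥ N₀, (len (c ^ N * g) : ℤ) = a * N + t := by
  have hc1 : ∀ k : ℕ, dist len (c ^ k)⁻¹ 1 = a * k := fun k => by simp [dist, hc]
  have hd : ∀ N : ℕ, len (c ^ N * g) = dist len (c ^ N)⁻¹ g := fun N => by simp [dist]
  have hlow : ∀ N : ℕ, a * N ≤ len (c ^ N * g) + len g := fun N => by
    have h1 := h.dist_triangle (c ^ N)⁻¹ g 1
    have h2 : dist len g 1 = len g := by simp [dist, h.inv]
    have h3 := hc1 N
    have h4 := hd N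
    omega
  have hmono : ∀ N k : ℕ, len (c ^ (N + k) * g) ≤ len (c ^ N * g) + a * k := fun N k => by
    have h1 := h.dist_triangle (c ^ (N + k))⁻¹ (c ^ N)⁻¹ g
    have h2 : dist len (c ^ (N + k))⁻¹ (c ^ N)⁻¹ = a * k := by
      rw [← hc k, dist]
      congr 1
      rw [inv_inv, add_comm, pow_add, mul_inv_cancel_right]
    rw [hd, hd]
    omega
  let F : ℕ → ℕ := fun N => len (c ^ N * g) + len g - a * N
  obtain ⟨N₀, hN₀⟩ : ∃ N₀, ∀ N, F N₀ ≤ F N := by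
    obtain ⟨N₀, hN₀⟩ := WellFounded.has_min (wellFounded_lt (α := ℕ)) (Set.range F)
      ⟨F 0, 0, rfl⟩
    obtain ⟨⟨N₀, rfl⟩, h2⟩ := hN₀
    exact ⟨N₀, fun N => not_lt.1 (h2 (F N) ⟨N, rfl⟩)⟩
  refine ⟨(F N₀ : ℤ) - len g, N₀, fun N hN => ?_⟩
  obtain ⟨k, rfl⟩ := Nat.exists_eq_add_of_le hN
  have h1 : F N₀ ≤ F (N₀ + k) := hN₀ _
  have h2 := hmono N₀ k
  have h3 := hlow N₀
  have h4 := hlow (N₀ + k)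
  simp only [F] at h1 ⊢
  have h5 : a * (N₀ + k) = a * N₀ + a * k := by ring
  rw [h5] at h1 h4
  push_cast [h3]
  have h6 : (a : ℤ) * (N₀ + k) = ((a * N₀ + a * k : ℕ) : ℤ) := by push_cast; ring
  have h7 : (a : ℤ) * N₀ = ((a * N₀ : ℕ) : ℤ) := by push_cast; ring
  rw [h6, h7]
  omega

theorem len_add_len (h : IsTreeLength len) {c : Γ} {a : ℕ} (ha : 0 < a)
    (hc : ∀ k : ℕ, len (c ^ k) = a * k) {g : Γ} {N : ℕ} (hg : Commute g (c ^ N))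
    (hN : len g < N) : len (c ^ N * g) + len ((c ^ N)⁻¹ * g) = 2 * (a * N) := by
  have hlt : len g < a * N := lt_of_lt_of_le hN (Nat.le_mul_of_pos_left N ha)
  set z := c ^ N with hz
  have d0 : ∀ x, dist len x (x * z) = a * N := fun x => by simp [dist, hz, hc]
  have d0' : ∀ x, dist len (x * z⁻¹) x = a * N := fun x => by
    have := d0 (x * z⁻¹)
    simpa using this
  have d1 : dist len z⁻¹ z = 2 * (a * N) := by
    rw [dist, inv_inv, hz, ← pow_add, hc]
    ring
  have d2 : dist len (g * z⁻¹) (g * z) = 2 * (a * N) := by rw [dist_mul_left, d1]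
  have d3 : dist len z⁻¹ (g * z⁻¹) = len g := by
    rw [dist, inv_inv, ← mul_assoc, ← hg.eq, mul_inv_cancel_right]
  have d4 : dist len z (g * z) = len g := by
    rw [dist, hg.eq, inv_mul_cancel_left]
  have e1 : len (z * g) = dist len z⁻¹ g := by simp [dist]
  have e2 : len (z⁻¹ * g) = dist len z g := rfl
  have q1 := h.four_point_dist (g * z⁻¹) (g * z) g z⁻¹
  have q2 := h.four_point_dist z⁻¹ (g * z) g z
  have t1 := h.dist_triangle z⁻¹ g z
  have := d0 g
  have := d0' g
  have := h.dist_comm z g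
  have := h.dist_comm z⁻¹ g
  have := h.dist_comm z (g * z)
  have := h.dist_comm (g * z) g
  have := h.dist_comm (g * z⁻¹) g
  have := h.dist_comm z⁻¹ (g * z⁻¹)
  have := h.dist_comm z⁻¹ (g * z)
  omega

/-- The elements commensurating a hyperbolic element act on its axis by translations. -/
theorem exists_translation (h : IsTreeLength len) {c : Γ} {a : ℕ} (ha : 0 < a)
    (hc : ∀ k : ℕ, len (c ^ k) = a * k) :
    ∃ τ : Γ → ℤ, (∀ g ∈ commensurator c, ∀ g' ∈ commensurator c, τ (g * g') = τ g + τ g') ∧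
      ∀ g ∈ commensurator c, |τ g| = len g := by
  choose τ N₀ hτ using h.exists_busemann hc
  have key : ∀ g ∈ commensurator c, ∃ m : ℕ, 0 < m ∧ ∃ N₁ : ℕ, ∀ N ≥ N₁, m ∣ N →
      (dist len (c ^ N)⁻¹ g : ℤ) = a * N + τ g ∧ (dist len g (c ^ N) : ℤ) = a * N - τ g := by
    rintro g ⟨m, hm, hg⟩
    refine ⟨m, hm, max (N₀ g) (len g + 1), fun N hN hmN => ?_⟩
    obtain ⟨k, rfl⟩ := hmN
    have h1 := hτ g (m * k) (le_of_max_le_left hN)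
    have hg' : Commute g (c ^ (m * k)) := by
      rw [pow_mul]
      exact hg.pow_right k
    have h2 := h.len_add_len ha hc hg' (by omega)
    have e1 : len (c ^ (m * k) * g) = dist len (c ^ (m * k))⁻¹ g := by simp [dist]
    have e2 : len ((c ^ (m * k))⁻¹ * g) = dist len g (c ^ (m * k)) := h.dist_comm _ _
    rw [e1] at h1 h2
    rw [e2] at h2
    refine ⟨h1, ?_⟩
    have h3 : ((a * (m * k) : ℕ) : ℤ) = a * (m * k : ℕ) := by push_cast; ring
    rw [← h3] at h1 ⊢
    omega
  have hdist : ∀ g ∈ commensurator c, ∀ g' ∈ commensurator c,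
      (dist len g g' : ℤ) = |τ g - τ g'| := by
    intro g hg g' hg'
    obtain ⟨m, hm, N₁, h1⟩ := key g hg
    obtain ⟨m', hm', N₁', h1'⟩ := key g' hg'
    let N := m * m' * (N₁ + N₁')
    have hp : 0 < m * m' := Nat.mul_pos hm hm'
    have hN : N₁ + N₁' ≤ N := Nat.le_mul_of_pos_left _ hp
    obtain ⟨p1, p2⟩ := h1 N (by omega) ⟨m' * (N₁ + N₁'), by simp only [N]; ring⟩
    obtain ⟨p1', p2'⟩ := h1' N (by omega) ⟨m * (N₁ + N₁'), by simp only [N]; ring⟩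
    have d1 : (dist len (c ^ N)⁻¹ (c ^ N) : ℤ) = 2 * (a * N) := by
      rw [dist, inv_inv, ← pow_add, hc]
      push_cast
      ring
    have q := h.four_point_dist g g' (c ^ N)⁻¹ (c ^ N)
    have t1 := h.dist_triangle (c ^ N)⁻¹ g g'
    have t2 := h.dist_triangle (c ^ N)⁻¹ g' g
    have := h.dist_comm g g'
    have := h.dist_comm g (c ^ N)⁻¹
    have := h.dist_comm g' (c ^ N)⁻¹
    rcases abs_cases (τ g - τ g') with ⟨h3, h4⟩ | ⟨h3, h4⟩ <;> omega
  have hone : τ 1 = 0 := by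
    have h1 := hτ 1 (N₀ 1) le_rfl
    rw [mul_one, hc] at h1
    push_cast at h1
    linarith
  have hlen : ∀ g ∈ commensurator c, |τ g| = len g := by
    intro g hg
    have := hdist g hg 1 (one_mem _)
    rw [hone, sub_zero] at this
    rw [← this, dist, mul_one, h.inv]
  refine ⟨τ, fun g hg g' hg' => ?_, hlen⟩
  obtain ⟨m, hm, hgm⟩ := id hg
  have hshift : ∀ (x : Γ) (M : ℕ), τ (c ^ M * x) = a * M + τ x := fun x M => by
    have h1 := hτ (c ^ M * x) (N₀ (c ^ M * x) + N₀ x) (by omega)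
    have h2 := hτ x (N₀ (c ^ M * x) + N₀ x + M) (by omega)
    rw [← mul_assoc, ← pow_add, h2] at h1
    push_cast at h1
    linarith
  have hcM : ∀ M : ℕ, c ^ M ∈ commensurator c := fun M =>
    ⟨1, one_pos, by rw [pow_one]; exact (Commute.refl c).pow_left M⟩
  let M := m * ((τ (g * g')).natAbs + (τ g).natAbs + (τ g').natAbs)
  have hM : (τ (g * g')).natAbs + (τ g).natAbs + (τ g').natAbs ≤ a * M :=
    (Nat.le_mul_of_pos_left _ hm).trans (Nat.le_mul_of_pos_left _ ha)
  have hgM : Commute g (c ^ M) := by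
    simp only [M]
    rw [pow_mul]
    exact hgm.pow_right _
  have h1 := hdist g hg (g * (c ^ M * g')) (mul_mem hg (mul_mem (hcM M) hg'))
  have h2 : (dist len g (g * (c ^ M * g')) : ℤ) = |τ (c ^ M * g')| := by
    rw [hlen _ (mul_mem (hcM M) hg'), dist, inv_mul_cancel_left]
  rw [h2, ← mul_assoc, hgM.eq, mul_assoc, hshift, hshift] at h1
  have h3 : ((a * M : ℕ) : ℤ) = a * M := by push_cast; ring
  rw [← h3] at h1
  rw [abs_of_nonneg (by omega), abs_of_nonpos (by omega)] at h1
  omega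

/-- If no nontrivial element fixes the axis of `c` pointwise, the commensurator is cyclic. -/
theorem isCyclic_commensurator (h : IsTreeLength len) {c : Γ} {a : ℕ} (ha : 0 < a)
    (hc : ∀ k : ℕ, len (c ^ k) = a * k)
    (hker : ∀ g ∈ commensurator c, (∀ g' ∈ commensurator c, len (g'⁻¹ * g * g') = 0) → g = 1) :
    IsCyclic (commensurator c) := by
  obtain ⟨τ, hadd, hlen⟩ := h.exists_translation ha hc
  let f : commensurator c →* Multiplicative ℤ :=
    { toFun := fun g => Multiplicative.ofAdd (τ g)
      map_one' := by
        have := hadd 1 (one_mem _) 1 (one_mem _)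
        rw [mul_one] at this
        change Multiplicative.ofAdd (τ 1) = Multiplicative.ofAdd 0
        congr 1
        omega
      map_mul' := fun x y => by
        change Multiplicative.ofAdd (τ (x * y)) = Multiplicative.ofAdd (τ x + τ y)
        rw [hadd x x.2 y y.2] }
  refine isCyclic_of_injective f ((injective_iff_map_eq_one f).2 fun g hg => Subtype.ext ?_)
  refine hker g g.2 fun g' hg' => ?_
  have h0 : ∀ x : commensurator c, f x = 1 → len x = 0 := fun x hx => by
    have h1 : τ x = 0 := hx
    have h2 := hlen x x.2
    rw [h1, abs_zero] at h2
    exact_mod_cast h2.symm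
  refine h0 (⟨g', hg'⟩⁻¹ * g * ⟨g', hg'⟩) ?_
  rw [map_mul, map_mul, hg, map_inv]
  simp

end IsTreeLength

/-! ### Involutions and infinite dihedral groups -/

section Dihedral

variable {G : Type*} [Group G]

theorem isInvol_iff {s : G} : IsInvol s ↔ s * s = 1 ∧ s ≠ 1 := by
  rw [← sq]
  exact orderOf_eq_prime_iff

theorem IsInvol.mul_self {s : G} (h : IsInvol s) : s * s = 1 := (isInvol_iff.1 h).1

theorem IsInvol.ne_one {s : G} (h : IsInvol s) : s ≠ 1 := (isInvol_iff.1 h).2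

theorem IsInvol.inv_eq {s : G} (h : IsInvol s) : s⁻¹ = s :=
  inv_eq_of_mul_eq_one_left h.mul_self

theorem IsInvol.map {H : Type*} [Group H] {f : G →* H} (hf : Function.Injective f) {s : G}
    (h : IsInvol s) : IsInvol (f s) :=
  (orderOf_injective f hf s).trans h

theorem isInvol_map_iff {H : Type*} [Group H] {f : G →* H} (hf : Function.Injective f) {s : G} :
    IsInvol (f s) ↔ IsInvol s := by
  unfold IsInvol
  rw [orderOf_injective f hf s]

theorem IsInvol.conj {s : G} (h : IsInvol s) (g : G) : IsInvol (g⁻¹ * s * g) := by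
  have e : g⁻¹ * s * g * (g⁻¹ * s * g) = g⁻¹ * (s * s) * g := by group
  refine isInvol_iff.2 ⟨by rw [e, h.mul_self]; group, fun h1 => h.ne_one ?_⟩
  have : s = g * (g⁻¹ * s * g) * g⁻¹ := by group
  rw [this, h1]
  group

theorem conj_conj (g h x : G) : h⁻¹ * (g⁻¹ * x * g) * h = (g * h)⁻¹ * x * (g * h) := by group

theorem eq_conj_inv {g x y : G} (h : g⁻¹ * x * g = y) : (g⁻¹)⁻¹ * y * g⁻¹ = x := by
  rw [← h]
  group

theorem conj_mul_zpow (g a b : G) (m : ℤ) :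
    (g⁻¹ * a * g * (g⁻¹ * b * g)) ^ m = g⁻¹ * (a * b) ^ m * g := by
  have e : g⁻¹ * a * g * (g⁻¹ * b * g) = g⁻¹ * (a * b) * (g⁻¹)⁻¹ := by group
  rw [e, conj_zpow, inv_inv]

theorem zpow_mul_comm_of_sq {a b : G} (ha : a * a = 1) (hb : b * b = 1) (k : ℤ) :
    (a * b) ^ k * a = a * (a * b) ^ (-k) := by
  have ha' : a⁻¹ = a := inv_eq_of_mul_eq_one_left ha
  have hb' : b⁻¹ = b := inv_eq_of_mul_eq_one_left hb
  have e : a⁻¹ * (a * b) * a = (a * b)⁻¹ := by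
    rw [mul_inv_rev, ha', hb', ← mul_assoc, ha, one_mul]
  have e2 := conj_zpow (a := a⁻¹) (b := a * b) (i := k)
  rw [inv_inv, e, inv_zpow, ← zpow_neg] at e2
  rw [e2]
  group

/-- The homomorphism from the infinite dihedral group given by two elements of order two. -/
def dihedralHom (a b : G) (ha : a * a = 1) (hb : b * b = 1) : DihedralGroup 0 →* G where
  toFun
    | .r i => HPow.hPow (β := ℤ) (a * b) i
    | .sr i => a * HPow.hPow (β := ℤ) (a * b) i
  map_one' := zpow_zero _
  map_mul' := by
    have key : ∀ i k : ℤ, a * (a * b) ^ (k - i) = (a * b) ^ i * (a * (a * b) ^ k) := fun i k => by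
      rw [← mul_assoc, zpow_mul_comm_of_sq ha hb, mul_assoc, ← zpow_add, neg_add_eq_sub]
    rintro (i | i) (k | k)
    · exact zpow_add (a * b) i k
    · exact key i k
    · exact (congrArg (a * ·) (zpow_add (a * b) i k)).trans (mul_assoc _ _ _).symm
    · refine Eq.trans ?_ (mul_assoc _ _ _).symm
      refine Eq.trans ?_ (congrArg (a * ·) (key i k))
      rw [← mul_assoc, ha, one_mul]
      rfl

theorem dihedralHom_sr (a b : G) (ha : a * a = 1) (hb : b * b = 1) (i : ℤ) :
    dihedralHom a b ha hb (.sr i) = a * (a * b) ^ i := rfl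

theorem range_dihedralHom (a b : G) (ha : a * a = 1) (hb : b * b = 1) :
    (dihedralHom a b ha hb).range = Subgroup.closure {a, b} := by
  have hab : a * b ∈ Subgroup.closure ({a, b} : Set G) :=
    mul_mem (Subgroup.subset_closure (by simp)) (Subgroup.subset_closure (by simp))
  have haa : a ∈ Subgroup.closure ({a, b} : Set G) := Subgroup.subset_closure (by simp)
  apply le_antisymm
  · rintro _ ⟨i | i, rfl⟩
    · exact zpow_mem hab _
    · exact mul_mem haa (zpow_mem hab _)
  · rw [Subgroup.closure_le]
    rintro x (rfl | rfl)
    · refine ⟨.sr (0 : ℤ), ?_⟩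
      rw [dihedralHom_sr, zpow_zero, mul_one]
    · refine ⟨.sr (1 : ℤ), ?_⟩
      rw [dihedralHom_sr, zpow_one, ← mul_assoc, ha, one_mul]

theorem mem_closure_pair_iff {a b : G} (ha : a * a = 1) (hb : b * b = 1) {g : G} :
    g ∈ Subgroup.closure {a, b} ↔ ∃ k : ℤ, g = (a * b) ^ k ∨ g = a * (a * b) ^ k := by
  rw [← range_dihedralHom a b ha hb]
  constructor
  · rintro ⟨i | i, h⟩
    · exact ⟨i, Or.inl h.symm⟩
    · exact ⟨i, Or.inr h.symm⟩
  · rintro ⟨k, rfl | rfl⟩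
    · exact ⟨.r k, rfl⟩
    · exact ⟨.sr k, rfl⟩

theorem zpow_eq_zpow_iff_of_not_isOfFinOrder {x : G} (hx : ¬ IsOfFinOrder x) {m n : ℤ} :
    x ^ m = x ^ n ↔ m = n :=
  (injective_zpow_iff_not_isOfFinOrder.2 hx).eq_iff

theorem zpow_eq_one_iff_of_not_isOfFinOrder {x : G} (hx : ¬ IsOfFinOrder x) {m : ℤ} :
    x ^ m = 1 ↔ m = 0 := by
  rw [← zpow_zero x, zpow_eq_zpow_iff_of_not_isOfFinOrder hx]

theorem mul_zpow_mul_self {a b : G} (ha : a * a = 1) (hb : b * b = 1) (k : ℤ) :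
    a * (a * b) ^ k * (a * (a * b) ^ k) = 1 := by
  rw [← mul_assoc, mul_assoc a, zpow_mul_comm_of_sq ha hb, ← mul_assoc, ha, one_mul,
    ← zpow_add, neg_add_cancel, zpow_zero]

theorem isInvol_mul_zpow {a b : G} (ha : IsInvol a) (hb : IsInvol b)
    (hab : ¬ IsOfFinOrder (a * b)) (k : ℤ) : IsInvol (a * (a * b) ^ k) := by
  refine isInvol_iff.2 ⟨mul_zpow_mul_self ha.mul_self hb.mul_self k, fun h1 => ?_⟩
  have h2 : a = (a * b) ^ (-k) := by
    rw [zpow_neg]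
    exact eq_inv_of_mul_eq_one_left h1
  have h3 : (a * b) ^ (-k + -k) = 1 := by rw [zpow_add, ← h2, ha.mul_self]
  rw [zpow_eq_one_iff_of_not_isOfFinOrder hab] at h3
  have h4 : k = 0 := by omega
  rw [h4, neg_zero, zpow_zero] at h2
  exact ha.ne_one h2

theorem dihedralHom_injective {a b : G} (ha : IsInvol a) (hb : IsInvol b)
    (hab : ¬ IsOfFinOrder (a * b)) :
    Function.Injective (dihedralHom a b ha.mul_self hb.mul_self) := by
  rw [injective_iff_map_eq_one]
  rintro (i | i) h
  · have := (zpow_eq_one_iff_of_not_isOfFinOrder hab (m := (i : ℤ))).1 h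
    exact congrArg DihedralGroup.r this
  · exact absurd h (isInvol_mul_zpow ha hb hab _).ne_one

theorem zpow_of_mul_self_ne_one {a b : G} (ha : a * a = 1) (hb : b * b = 1) {g : G}
    (hg : g ∈ Subgroup.closure {a, b}) (h : g * g ≠ 1) : ∃ k : ℤ, k ≠ 0 ∧ g = (a * b) ^ k := by
  obtain ⟨k, rfl | rfl⟩ := (mem_closure_pair_iff ha hb).1 hg
  · refine ⟨k, ?_, rfl⟩
    rintro rfl
    simp at h
  · exact absurd (mul_zpow_mul_self ha hb k) h

theorem conj_zpow_of_mem_closure_pair {a b : G} (ha : a * a = 1) (hb : b * b = 1) {g : G}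
    (hg : g ∈ Subgroup.closure {a, b}) (m : ℤ) :
    g⁻¹ * (a * b) ^ m * g = (a * b) ^ m ∨ g⁻¹ * (a * b) ^ m * g = (a * b) ^ (-m) := by
  obtain ⟨k, rfl | rfl⟩ := (mem_closure_pair_iff ha hb).1 hg
  · left
    rw [← zpow_neg, ← zpow_add, ← zpow_add]
    congr 1
    ring
  · right
    have e : (a * (a * b) ^ k)⁻¹ * (a * b) ^ m * (a * (a * b) ^ k) =
        ((a * b) ^ k)⁻¹ * (a⁻¹ * ((a * b) ^ m * a)) * (a * b) ^ k := by group
    rw [e, zpow_mul_comm_of_sq ha hb, inv_mul_cancel_left, ← zpow_neg, ← zpow_add, ← zpow_add]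
    congr 1
    ring

theorem conj_mem_closure_pair {a b x : G} (g : G) (hx : x ∈ Subgroup.closure {a, b}) :
    g⁻¹ * x * g ∈ Subgroup.closure {g⁻¹ * a * g, g⁻¹ * b * g} := by
  induction hx using Subgroup.closure_induction with
  | mem x hx =>
    rcases hx with rfl | rfl
    · exact Subgroup.subset_closure (by simp)
    · exact Subgroup.subset_closure (by simp)
  | one => simp [one_mem]
  | mul x y _ _ hx hy =>
    have : g⁻¹ * (x * y) * g = g⁻¹ * x * g * (g⁻¹ * y * g) := by group
    rw [this]
    exact mul_mem hx hy
  | inv x _ hx =>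
    have : g⁻¹ * x⁻¹ * g = (g⁻¹ * x * g)⁻¹ := by group
    rw [this]
    exact inv_mem hx

/-- Two involutions generating an infinite dihedral group that contains the commensurator of
each of its infinite cyclic subgroups. -/
structure IsMalnormalPair (a b : G) : Prop where
  left : IsInvol a
  right : IsInvol b
  ne : a ≠ b
  mem_of_conj : ∀ (g : G) (m n : ℤ), m ≠ 0 → n ≠ 0 → g⁻¹ * (a * b) ^ m * g = (a * b) ^ n →
    g ∈ Subgroup.closure {a, b}

theorem IsMalnormalPair.conj {a b : G} (h : IsMalnormalPair a b) (g : G) :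
    IsMalnormalPair (g⁻¹ * a * g) (g⁻¹ * b * g) where
  left := h.left.conj g
  right := h.right.conj g
  ne := by simpa using h.ne
  mem_of_conj x m n hm hn hx := by
    rw [conj_mul_zpow, conj_mul_zpow] at hx
    have h1 := h.mem_of_conj (g * x * g⁻¹) m n hm hn (by
      have e : (g * x * g⁻¹)⁻¹ * (a * b) ^ m * (g * x * g⁻¹) =
        g * (x⁻¹ * (g⁻¹ * (a * b) ^ m * g) * x) * g⁻¹ := by group
      rw [e, hx]
      group)
    have := conj_mem_closure_pair g h1
    have e : g⁻¹ * (g * x * g⁻¹) * g = x := by group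
    rwa [e] at this

/-- The properties of a group with involutions `j`, `t` that are preserved by embedding it
into larger groups where more pairs of involutions are conjugate to `(j, t)`. -/
structure IsDihedralGood (j t : G) : Prop where
  left : IsInvol j
  right : IsInvol t
  ne : j ≠ t
  not_isOfFinOrder : ∀ r s : G, IsInvol r → IsInvol s → r ≠ s → ¬ IsOfFinOrder (r * s)
  eq_one_of_commute : ∀ x : G, Commute x j → Commute x t → x = 1
  exists_conj : ∀ k l : ℤ, k ≠ l → ∃ x : G, x⁻¹ * j * x = j * (j * t) ^ k ∧
    x⁻¹ * t * x = j * (j * t) ^ l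
  conj_or_malnormal : ∀ r s : G, IsInvol r → IsInvol s → r ≠ s →
    (∃ x : G, x⁻¹ * j * x = r ∧ x⁻¹ * t * x = s) ∨
      ∃ a b : G, IsMalnormalPair a b ∧ r ∈ Subgroup.closure {a, b} ∧
        s ∈ Subgroup.closure {a, b}

theorem eq_of_commute_of_isInvol
    (H : ∀ r s : G, IsInvol r → IsInvol s → r ≠ s → ¬ IsOfFinOrder (r * s))
    {r s : G} (hr : IsInvol r) (hs : IsInvol s) (h : Commute r s) : r = s := by
  by_contra hne
  refine H r s hr hs hne (isOfFinOrder_iff_pow_eq_one.2 ⟨2, two_pos, ?_⟩)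
  rw [h.mul_pow, sq, sq, hr.mul_self, hs.mul_self, one_mul]

end Dihedral

/-! ### The base group -/

namespace StandingHyp

variable {G : Type*} [Group G] {j t t' : G}

theorem eq_one_or_exists_of_commute_zpow (H : StandingHyp j t t') {s x : G} (hs : IsInvol s)
    (hne : s ≠ j) {n : ℤ} (hn : n ≠ 0) (hx : Commute x ((j * s) ^ n)) :
    x = 1 ∨ ∃ s', IsInvol s' ∧ JEquiv j s' s ∧ x = j * s' := by
  have hfin := H.infinite_order j s H.invol_j hs hne.symm
  have hu := isInvol_mul_zpow H.invol_j hs hfin n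
  have e : j * (j * (j * s) ^ n) = (j * s) ^ n := by
    rw [← mul_assoc, H.invol_j.mul_self, one_mul]
  have hne' : j * (j * s) ^ n ≠ j := by
    intro h
    rw [mul_eq_left, zpow_eq_one_iff_of_not_isOfFinOrder hfin] at h
    exact hn h
  have h1 := (H.centralizer_eq _ hu hne' x).1 (by
    rw [e]
    exact Subgroup.mem_centralizer_singleton_iff.2 hx.eq)
  rcases h1 with rfl | ⟨s', hs', ⟨p, q, hp, hq, hpq⟩, rfl⟩
  · exact Or.inl rfl
  · refine Or.inr ⟨s', hs', ⟨p, n * q, hp, mul_ne_zero hn hq, ?_⟩, rfl⟩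
    rw [hpq, e, ← zpow_mul]

theorem commute_of_mem_centralizer {x : G} (hx : x ∈ Subgroup.centralizer ({j} : Set G)) :
    Commute x j := Subgroup.mem_centralizer_singleton_iff.1 hx

/-- The centralizer of an involution acts freely on the other involutions. -/
theorem eq_one_of_commute (H : StandingHyp j t t') {s x : G} (hs : IsInvol s)
    (hne : s ≠ j) (hj : Commute x j) (hx : Commute x s) : x = 1 := by
  rcases (H.centralizer_eq s hs hne x).1
    (Subgroup.mem_centralizer_singleton_iff.2 (hj.mul_right hx).eq) with rfl | ⟨s', hs', -, rfl⟩
  · rfl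
  · have h1 : Commute s' j := by
      have := hj.eq
      have e := congrArg (fun y => j * y) this
      simp only [← mul_assoc, H.invol_j.mul_self, one_mul] at e
      exact e
    rw [eq_of_commute_of_isInvol H.infinite_order hs' H.invol_j h1, H.invol_j.mul_self]

/-- Minimal involutions give malnormal pairs. -/
theorem isMalnormalPair (H : StandingHyp j t t') {s : G} (hs : IsInvol s) (hne : s ≠ j)
    (hmin : JMinimal j s) : IsMalnormalPair j s := by
  have hfin := H.infinite_order j s H.invol_j hs hne.symm
  have hcen : ∀ (x : G) (n : ℤ), n ≠ 0 → Commute x ((j * s) ^ n) → ∃ k : ℤ, x = (j * s) ^ k := by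
    intro x n hn hx
    rcases H.eq_one_or_exists_of_commute_zpow hs hne hn hx with rfl | ⟨s', hs', hss', rfl⟩
    · exact ⟨0, by simp⟩
    · have h1 : s' ∈ Subgroup.closure {j, s} :=
        hmin s' hs' hss' (Subgroup.subset_closure (by simp))
      obtain ⟨k, hk | hk⟩ := (mem_closure_pair_iff H.invol_j.mul_self hs.mul_self).1 h1
      · exfalso
        have h2 := hs'.mul_self
        rw [hk, ← zpow_add, zpow_eq_one_iff_of_not_isOfFinOrder hfin] at h2
        have h3 : k = 0 := by omega
        rw [h3, zpow_zero] at hk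
        exact hs'.ne_one hk
      · exact ⟨k, by rw [hk, ← mul_assoc, H.invol_j.mul_self, one_mul]⟩
  refine ⟨H.invol_j, hs, hne.symm, fun g m n hm hn hg => ?_⟩
  have hsc : Commute (j * s) ((j * s) ^ m) := Commute.self_zpow _ _
  have hsc' : Commute (j * s) ((j * s) ^ n) := Commute.self_zpow _ _
  obtain ⟨p, hp⟩ := hcen (g⁻¹ * (j * s) * g) n hn (by
    rw [← hg]
    have e : ∀ y, g⁻¹ * y * g = MulAut.conj g⁻¹ y := fun y => by simp
    rw [e, e]
    exact hsc.map _)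
  obtain ⟨q, hq⟩ := hcen (g * (j * s) * g⁻¹) m hm (by
    have e : ∀ y, g * y * g⁻¹ = MulAut.conj g y := fun y => by simp
    have e2 : (j * s) ^ m = g * (j * s) ^ n * g⁻¹ := by
      rw [← hg]
      group
    rw [e2, e, e]
    exact hsc'.map _)
  have hpq : (j * s) ^ (p * q) = (j * s) ^ (1 : ℤ) := by
    rw [zpow_mul, ← hp]
    have e := conj_zpow (a := g⁻¹) (b := j * s) (i := q)
    rw [inv_inv] at e
    rw [e, ← hq]
    group
  rw [zpow_eq_zpow_iff_of_not_isOfFinOrder hfin] at hpq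
  have hjs : j * s ∈ Subgroup.closure ({j, s} : Set G) :=
    mul_mem (Subgroup.subset_closure (by simp)) (Subgroup.subset_closure (by simp))
  have hj : j ∈ Subgroup.closure ({j, s} : Set G) := Subgroup.subset_closure (by simp)
  rcases Int.isUnit_iff.1 (IsUnit.of_mul_eq_one _ hpq) with rfl | rfl
  · obtain ⟨k, rfl⟩ := hcen g 1 one_ne_zero (by
      rw [zpow_one] at hp ⊢
      have : g * (g⁻¹ * (j * s) * g) = j * s * g := by group
      rw [hp] at this
      exact this)
    exact zpow_mem hjs k
  · obtain ⟨k, hk⟩ := hcen (g * j) 1 one_ne_zero (by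
      rw [zpow_one]
      have h1 : g * (g⁻¹ * (j * s) * g) = j * s * g := by group
      have h2 := zpow_mul_comm_of_sq H.invol_j.mul_self hs.mul_self (-1)
      rw [neg_neg, zpow_one] at h2
      rw [hp] at h1
      change g * j * (j * s) = j * s * (g * j)
      rw [mul_assoc, ← h2, ← mul_assoc, h1, mul_assoc])
    have e : g = g * j * j := by rw [mul_assoc, H.invol_j.mul_self, mul_one]
    rw [e, hk]
    exact mul_mem (zpow_mem hjs k) hj

/-- Pairs of involutions containing `j` are conjugate to `(j, t)` or lie in a malnormal
infinite dihedral group. -/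
theorem conj_or_malnormal_left (H : StandingHyp j t t') {s : G} (hs : IsInvol s) (hne : s ≠ j) :
    (∃ x : G, x⁻¹ * j * x = j ∧ x⁻¹ * t * x = s) ∨
      ∃ s' : G, IsMalnormalPair j s' ∧ s ∈ Subgroup.closure {j, s'} := by
  by_cases h : ∃ a ∈ Subgroup.centralizer ({j} : Set G),
           ∃ b ∈ Subgroup.centralizer ({j} : Set G), s = a * t * b
  · left
    obtain ⟨a, ha, b, hb, rfl⟩ := h
    have hc := commute_of_mem_centralizer (mul_mem hb ha)
    have ha' := commute_of_mem_centralizer ha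
    have hb' := commute_of_mem_centralizer hb
    set c := b * a with hcdef
    have hcj : t ≠ j := by
      rintro rfl
      refine hne (eq_of_commute_of_isInvol H.infinite_order hs H.invol_j ?_)
      exact (ha'.mul_left (Commute.refl _)).mul_left hb'
    have h1 : t * c * t = c⁻¹ := by
      have h2 := (hs.conj a).mul_self
      have e : a⁻¹ * (a * t * b) * a = t * c := by
        rw [hcdef]
        group
      rw [e] at h2
      refine eq_inv_of_mul_eq_one_left ?_
      rw [← h2]
      group
    have h2 : Commute c (t * j * t) := by
      have h3 : c = t * c⁻¹ * t := by
        rw [← h1, ← mul_assoc, ← mul_assoc, H.invol_t.mul_self, one_mul, mul_assoc,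
          H.invol_t.mul_self, mul_one]
      have e : ∀ y, t * y * t = MulAut.conj t y := fun y => by
        rw [MulAut.conj_apply, H.invol_t.inv_eq]
      rw [h3, e, e]
      exact hc.inv_left.map _
    have htj : IsInvol (t * j * t) := by
      have := H.invol_j.conj t
      rwa [H.invol_t.inv_eq] at this
    have hc1 : c = 1 := by
      refine H.eq_one_of_commute htj (fun h4 => hcj ?_) hc h2
      refine eq_of_commute_of_isInvol H.infinite_order H.invol_t H.invol_j ?_
      have h5 := congrArg (fun y => y * t) h4
      simp only [mul_assoc, H.invol_t.mul_self, mul_one] at h5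
      exact h5
    have hba : b = a⁻¹ := eq_inv_of_mul_eq_one_left hc1
    refine ⟨a⁻¹, ?_, ?_⟩
    · rw [inv_inv, ha'.eq, mul_inv_cancel_right]
    · rw [inv_inv, hba]
  · right
    obtain ⟨s', ⟨hs', ⟨m, n, hm, hn, hmn⟩, hmin⟩, -⟩ := H.unique_minimal s hs h
    refine ⟨s', H.isMalnormalPair hs' ?_ hmin,
      hmin s hs ⟨n, m, hn, hm, hmn.symm⟩ (Subgroup.subset_closure (by simp))⟩
    rintro rfl
    rw [H.invol_j.mul_self, one_zpow, eq_comm, zpow_eq_one_iff_of_not_isOfFinOrder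
      (H.infinite_order s' s H.invol_j hs hne.symm)] at hmn
    exact hn hmn

theorem conj_or_malnormal (H : StandingHyp j t t') {r s : G} (hr : IsInvol r) (hs : IsInvol s)
    (hne : r ≠ s) :
    (∃ x : G, x⁻¹ * j * x = r ∧ x⁻¹ * t * x = s) ∨
      ∃ a b : G, IsMalnormalPair a b ∧ r ∈ Subgroup.closure {a, b} ∧
        s ∈ Subgroup.closure {a, b} := by
  obtain ⟨g, hg⟩ := isConj_iff.1 (H.all_conj j r H.invol_j hr)
  have e : g⁻¹ * r * g = j := by
    rw [← hg]
    group
  have hne' : g⁻¹ * s * g ≠ j := by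
    rw [← e]
    simpa using hne.symm
  have es : (g⁻¹)⁻¹ * (g⁻¹ * s * g) * g⁻¹ = s := by group
  rcases H.conj_or_malnormal_left (hs.conj g) hne' with ⟨x, hx, hx'⟩ | ⟨s', hs', hss'⟩
  · refine Or.inl ⟨x * g⁻¹, ?_, ?_⟩
    · rw [← conj_conj, hx, inv_inv, hg]
    · rw [← conj_conj, hx', es]
  · refine Or.inr ⟨_, _, hs'.conj g⁻¹, ?_, ?_⟩
    · rw [inv_inv, hg]
      exact Subgroup.subset_closure (by simp)
    · have := conj_mem_closure_pair g⁻¹ hss'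
      rwa [es] at this

theorem isDihedralGood (H : StandingHyp j t t') (hne : j ≠ t) : IsDihedralGood j t where
  left := H.invol_j
  right := H.invol_t
  ne := hne
  not_isOfFinOrder := H.infinite_order
  eq_one_of_commute x hj ht := H.eq_one_of_commute H.invol_t hne.symm hj ht
  exists_conj k l hkl := by
    obtain ⟨w, ⟨hw, hw2⟩, -⟩ := H.unique_root 2 two_pos
    have hfin := H.infinite_order j t H.invol_j H.invol_t hne
    have hjj := H.invol_j.mul_self
    set y := j * w with hy
    have hy2 : ∀ i : ℤ, (j * t) ^ i = y ^ (2 * i) := fun i => by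
      rw [← hw2, ← zpow_natCast, ← zpow_mul]
      rfl
    have hyj : ∀ i : ℤ, y ^ i * j = j * y ^ (-i) := zpow_mul_comm_of_sq hjj hw.mul_self
    set u := j * y ^ k with hu
    have huu : u * u = 1 := mul_zpow_mul_self hjj hw.mul_self k
    have hui : u⁻¹ = u := inv_eq_of_mul_eq_one_left huu
    have hs := isInvol_mul_zpow H.invol_j H.invol_t hfin (k - l)
    obtain ⟨a, ha, hat⟩ := H.conj_in_A _ hs ⟨1, k - l, one_ne_zero, sub_ne_zero.2 hkl, by
      rw [← mul_assoc, hjj, one_mul, zpow_one]⟩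
    have haj : a⁻¹ * j * a = j := by
      rw [mul_assoc, ← (commute_of_mem_centralizer ha).eq, inv_mul_cancel_left]
    have key : ∀ i m : ℤ, j * y ^ i * (j * y ^ m) = y ^ (m - i) := fun i m => by
      rw [mul_assoc, ← mul_assoc (y ^ i), hyj, ← mul_assoc, ← mul_assoc, hjj, one_mul,
        ← zpow_add, neg_add_eq_sub]
    refine ⟨a * u, ?_, ?_⟩
    · rw [← conj_conj, haj, hui, hy2, hu]
      nth_rewrite 2 [← mul_one j]
      rw [← zpow_zero y, key, ← mul_assoc, hyj, mul_assoc, ← zpow_add]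
      congr 2
      ring
    · rw [← conj_conj, hat, hui, hy2, hy2, hu, key, ← mul_assoc, hyj, mul_assoc, ← zpow_add]
      congr 2
      ring
  conj_or_malnormal _ _ := H.conj_or_malnormal

end StandingHyp

section Malnormal

variable {Γ : Type*} [Group Γ]

theorem conj_zpow_of_conj {g x y : Γ} (h : g⁻¹ * x * g = y) (k : ℤ) :
    g⁻¹ * x ^ k * g = y ^ k := by
  have := conj_zpow (a := g⁻¹) (b := x) (i := k)
  rw [inv_inv, h] at this
  exact this.symm

theorem mem_commensurator_of_commute_zpow {c g : Γ} {m : ℤ} (hm : m ≠ 0)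
    (h : Commute g (c ^ m)) : g ∈ IsTreeLength.commensurator c := by
  refine ⟨m.natAbs, Int.natAbs_pos.2 hm, ?_⟩
  rcases Int.natAbs_eq m with e | e
  · rwa [e, zpow_natCast] at h
  · rw [e, zpow_neg, zpow_natCast] at h
    simpa using h.inv_right

/-- Translation lengths of conjugate elements agree. -/
theorem IsTreeLength.natAbs_eq_of_conj_zpow {len : Γ → ℕ} (h : IsTreeLength len) {c : Γ} {a : ℕ}
    (ha : 0 < a) (hc : ∀ k : ℕ, len (c ^ k) = a * k) {g : Γ} {m n : ℤ}
    (hg : g⁻¹ * c ^ m * g = c ^ n) : m.natAbs = n.natAbs := by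
  have hz : ∀ k : ℤ, len (c ^ k) = a * k.natAbs := fun k => by
    rcases Int.natAbs_eq k with e | e
    · rw [e, zpow_natCast, hc, Int.natAbs_natCast]
    · rw [e, zpow_neg, zpow_natCast, h.inv, hc, Int.natAbs_neg, Int.natAbs_natCast]
  have hmul : ∀ x y, len (x * y) ≤ len x + len y := fun x y => by
    have := h.dist_triangle x⁻¹ 1 y
    simpa [IsTreeLength.dist] using this
  have hle : ∀ (g : Γ) (m n : ℤ), g⁻¹ * c ^ m * g = c ^ n → m.natAbs ≤ n.natAbs := by
    intro g m n hg
    set N : ℕ := 2 * len g + 1 with hN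
    have h1 : c ^ (m * N) = g * c ^ (n * N) * g⁻¹ := by
      rw [zpow_mul c n, ← conj_zpow_of_conj hg, zpow_mul]
      group
    have h2 := hmul (g * c ^ (n * N)) g⁻¹
    have h3 := hmul g (c ^ (n * N))
    rw [← h1, hz, h.inv] at h2
    rw [hz] at h3
    rw [Int.natAbs_mul, Int.natAbs_natCast] at h2 h3
    by_contra! hlt
    have h4 : a * ((n.natAbs + 1) * N) ≤ a * (m.natAbs * N) := by gcongr; omega
    have h5 : a * ((n.natAbs + 1) * N) = a * (n.natAbs * N) + a * N := by ring
    have h6 : N ≤ a * N := Nat.le_mul_of_pos_left N ha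
    omega
  exact le_antisymm (hle g m n hg) (hle g⁻¹ n m (eq_conj_inv hg))

/-- The stabilizer of a hyperbolic axis in a group acting acylindrically on a tree is
the infinite dihedral group containing it. -/
theorem IsTreeAction.exists_isMalnormalPair {V : Type*} [MulAction Γ V] {d : V → V → ℕ}
    (h : IsTreeAction Γ d)
    (hinf : ∀ r s : Γ, IsInvol r → IsInvol s → r ≠ s → ¬ IsOfFinOrder (r * s))
    (hacyl : ∀ (g : Γ) (x y : V), 3 ≤ d x y → d x (g • x) = 0 → d y (g • y) = 0 → g * g = 1)
    {r s : Γ} (hr : IsInvol r) (hs : IsInvol s) {x : V} {n : ℕ} (hn : 0 < n)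
    (hrx : d x (r • x) = 0) (hc : ∀ k : ℕ, d x ((r * s) ^ k • x) = 2 * n * k) :
    ∃ a b : Γ, IsMalnormalPair a b ∧ r ∈ Subgroup.closure {a, b} ∧
      s ∈ Subgroup.closure {a, b} := by
  set c := r * s with hcdef
  have hrr := hr.mul_self
  have hri := hr.inv_eq
  have hL := h.isTreeLength x
  have h2n : 0 < 2 * n := by omega
  have hcfin : ¬ IsOfFinOrder c := fun hf => by
    obtain ⟨k, hk, hk1⟩ := isOfFinOrder_iff_pow_eq_one.1 hf
    have := hc k
    rw [hk1, one_smul, h.self] at this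
    have := Nat.mul_pos h2n hk
    omega
  have hrc : ∀ k : ℤ, r⁻¹ * c ^ k * r = c ^ (-k) := fun k => by
    rw [mul_assoc, zpow_mul_comm_of_sq hrr hs.mul_self, inv_mul_cancel_left]
  set C := IsTreeLength.commensurator c with hC
  have hrC : r ∉ C := by
    rintro ⟨m, hm, hcomm⟩
    have h1 := hrc m
    rw [zpow_natCast, mul_assoc, ← hcomm.eq, inv_mul_cancel_left, ← zpow_natCast,
      zpow_eq_zpow_iff_of_not_isOfFinOrder hcfin] at h1
    omega
  have hconj : ∀ g ∈ C, r⁻¹ * g * r ∈ C := by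
    rintro g ⟨m, hm, hg⟩
    refine mem_commensurator_of_commute_zpow (m := -m) (by omega) ?_
    rw [← hrc, zpow_natCast]
    have := hg.map (MulAut.conj r⁻¹)
    simpa using this
  have hcyc : IsCyclic C := by
    refine hL.isCyclic_commensurator h2n hc fun g hg hker => ?_
    have hfix : ∀ g' ∈ C, d (g' • x) (g • g' • x) = 0 := fun g' hg' => by
      rw [← h.smul g'⁻¹, inv_smul_smul, ← mul_smul, ← mul_smul]
      exact hker g' hg'
    have hsq : ∀ g : Γ, (∀ g' ∈ C, d (g' • x) (g • g' • x) = 0) → g * g = 1 := fun g hg => by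
      have hc2 : c ^ 2 ∈ C := ⟨1, one_pos, by simp [Commute.refl, Commute.pow_left]⟩
      refine hacyl g x (c ^ 2 • x) ?_ (by simpa using hg 1 (one_mem _)) (hg _ hc2)
      rw [hc]
      omega
    have hg2 := hsq g hfix
    by_contra hg1
    have hgi : IsInvol g := isInvol_iff.2 ⟨hg2, hg1⟩
    have hgr : g ≠ r := by
      rintro rfl
      exact hrC hg
    have h4 : g * (r⁻¹ * g * r) * (g * (r⁻¹ * g * r)) = 1 := by
      refine hsq _ fun g' hg' => ?_
      have e1 := hfix _ (hconj g' hg')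
      have t0 : ∀ y, d (g • (r⁻¹ * g * r) • y) y ≤
        d (g • (r⁻¹ * g * r) • y) (g • y) + d (g • y) y := fun y => h.triangle _ _ _
      have e2 : d (g' • x) ((r⁻¹ * g * r) • g' • x) = 0 := by
        have em : r • (r⁻¹ * g * r) • g' • x = g • r • g' • x := by simp [mul_smul]
        rw [← h.smul r, em]
        have e3 : d (r • g' • x) ((r⁻¹ * g' * r) • x) = 0 := by
          rw [hri, mul_smul, mul_smul, h.smul, h.smul, hrx]
        have t1 := h.triangle (r • g' • x) ((r⁻¹ * g' * r) • x) (g • r • g' • x)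
        have t2 := h.triangle ((r⁻¹ * g' * r) • x) (g • (r⁻¹ * g' * r) • x) (g • r • g' • x)
        rw [h.smul g, h.comm _ (r • g' • x)] at t2
        omega
      have t := t0 (g' • x)
      rw [h.smul, h.comm, h.comm _ (g' • x), h.comm _ (g' • x)] at t
      have := hfix g' hg'
      rw [mul_smul]
      omega
    refine hinf g r hgi hr hgr (isOfFinOrder_iff_pow_eq_one.2 ⟨4, by norm_num, ?_⟩)
    rw [← h4, hri]
    simp only [pow_succ, pow_zero, one_mul, mul_assoc]
  obtain ⟨c₀, hc₀⟩ := hcyc.exists_zpow_surjective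
  obtain ⟨c₀, hc₀C⟩ := c₀
  have hgen : ∀ g ∈ C, ∃ k : ℤ, c₀ ^ k = g := fun g hg => by
    obtain ⟨k, hk⟩ := hc₀ ⟨g, hg⟩
    exact ⟨k, by simpa using congrArg Subtype.val hk⟩
  have hcC : c ∈ C := ⟨1, one_pos, by simp [Commute.refl]⟩
  obtain ⟨k, hk⟩ := hgen c hcC
  have hk0 : k ≠ 0 := by
    rintro rfl
    exact hcfin (hk ▸ by simp)
  have hc₀fin : ¬ IsOfFinOrder c₀ := fun hf => hcfin (hk ▸ hf.zpow)
  obtain ⟨l, hl⟩ := hgen _ (hconj c₀ hc₀C)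
  have hl1 : l = -1 := by
    have h1 := conj_zpow_of_conj hl.symm k
    have h2 := hrc 1
    rw [zpow_one, zpow_neg, zpow_one, ← hk, h1, ← zpow_mul, ← zpow_neg,
      zpow_eq_zpow_iff_of_not_isOfFinOrder hc₀fin] at h2
    have : l * k = (-1) * k := by linarith
    exact mul_right_cancel₀ hk0 this
  have hbb : r * c₀ * (r * c₀) = 1 := by
    have e : r * c₀ * (r * c₀) = r⁻¹ * c₀ * r * c₀ := by rw [hri, ← mul_assoc]
    rw [e, ← hl, hl1]
    simp
  have hb1 : r * c₀ ≠ 1 := fun h1 => by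
    have : c₀ = r := by rw [← hri, eq_inv_of_mul_eq_one_right h1]
    exact hrC (this ▸ hc₀C)
  have hab : r * (r * c₀) = c₀ := by rw [← mul_assoc, hrr, one_mul]
  have hmem : ∀ i : ℤ, c₀ ^ i ∈ Subgroup.closure {r, r * c₀} := fun i =>
    (mem_closure_pair_iff hrr hbb).2 ⟨i, Or.inl (by rw [hab])⟩
  have hrm : r ∈ Subgroup.closure {r, r * c₀} := Subgroup.subset_closure (by simp)
  refine ⟨r, r * c₀, ⟨hr, isInvol_iff.2 ⟨hbb, hb1⟩, fun h1 => ?_, ?_⟩, hrm, ?_⟩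
  · refine hc₀fin ?_
    rw [left_eq_mul.1 h1]
    exact IsOfFinOrder.one
  · intro g m m' hm hm' hg
    rw [hab] at hg
    have h1 : g⁻¹ * c ^ m * g = c ^ m' := by
      have := conj_zpow_of_conj hg k
      rwa [← zpow_mul, ← zpow_mul, mul_comm m, mul_comm m', zpow_mul, zpow_mul, hk] at this
    rcases Int.natAbs_eq_natAbs_iff.1 (hL.natAbs_eq_of_conj_zpow h2n hc h1) with e | e
    · have hgC : g ∈ C := mem_commensurator_of_commute_zpow hm (by
        rw [← e, mul_assoc, inv_mul_eq_iff_eq_mul] at h1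
        exact h1.symm)
      obtain ⟨i, rfl⟩ := hgen g hgC
      exact hmem i
    · have h2 : (g * r)⁻¹ * c ^ m * (g * r) = c ^ m := by
        rw [← conj_conj, h1, hrc, e]
      have hgC : g * r ∈ C := mem_commensurator_of_commute_zpow hm (by
        rw [mul_assoc _ (c ^ m), inv_mul_eq_iff_eq_mul] at h2
        exact h2.symm)
      obtain ⟨i, hi⟩ := hgen _ hgC
      have : g = c₀ ^ i * r := by rw [hi, mul_assoc, hrr, mul_one]
      rw [this]
      exact mul_mem (hmem i) hrm
  · have : s = r * c₀ ^ k := by rw [hk, hcdef, ← mul_assoc, hrr, one_mul]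
    rw [this]
    exact mul_mem hrm (hmem k)

end Malnormal

namespace HNNData

section Conjugation

variable {G : Type u} [Group G] (d : HNNData G)

theorem letter_mul_letter_bar (l : d.L) : d.letter l * d.letter (d.bar l) = 1 := by
  rw [letter_bar, mul_inv_cancel]

theorem letter_bar_mul_letter (l : d.L) : d.letter (d.bar l) * d.letter l = 1 := by
  rw [letter_bar, inv_mul_cancel]

theorem len_mul_of (x : d.extension) (g : G) : d.len (x * d.of g) = d.len x := by
  rw [← len_inv, mul_inv_rev, ← map_inv, len_of_mul, len_inv]

/-- If conjugation by a word with first letter `l` preserves a base element, then so does the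
conjugation by the word without that letter, and the result lies in the associated subgroup. -/
theorem exists_mem_of_conj_letter_mul {l : d.L} {y : d.extension} {u v : G}
    (hl : d.len (d.letter l * y) = d.len y + 1)
    (h : d.letter l * y * d.of u * (d.letter l * y)⁻¹ = d.of v) :
    v ∈ d.K (d.bar l) ∧ ∃ w ∈ d.K l, y * d.of u * y⁻¹ = d.of w := by
  set X := d.letter l * y with hX
  have hXy : d.letter (d.bar l) * X = y := by
    rw [hX, ← mul_assoc, letter_bar_mul_letter, one_mul]
  have hXv : d.of v * X = X * d.of u := by rw [← h, inv_mul_cancel_right]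
  have hv : v ∈ d.K (d.bar l) := by
    refine (d.eq_and_mem_of_len_letter_mul_lt (l := d.bar l) (l' := d.bar l) (x := X) ?_ ?_).2
    · rw [hXy]
      omega
    · rw [hXv, ← mul_assoc, hXy, len_mul_of]
      omega
  refine ⟨hv, d.φ (d.bar l) v, by simpa [d.bar_bar] using d.φ_mem _ _ hv, ?_⟩
  have e : y * d.of u = d.of (d.φ (d.bar l) v) * y := by
    conv_lhs => rw [← hXy, mul_assoc, ← hXv, ← mul_assoc, d.letter_mul_of _ hv, mul_assoc, hXy]
  rw [e, mul_inv_cancel_right]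

variable {d} in
theorem conj_of_conj_of_mul {g u v : G} {y : d.extension}
    (h : d.of g * y * d.of u * (d.of g * y)⁻¹ = d.of v) :
    y * d.of u * y⁻¹ = d.of (g⁻¹ * v * g) := by
  rw [map_mul, map_mul, map_inv, ← h]
  group

theorem not_cancels_of_len {l l' : d.L} {g : G} {z : d.extension}
    (h : d.len z + 1 < d.len (d.letter l * (d.of g * (d.letter l' * z)))) :
    ¬ (l' = d.bar l ∧ g ∈ d.K l) := by
  rintro ⟨rfl, hg⟩
  rw [← mul_assoc, d.letter_mul_of l hg, mul_assoc, ← mul_assoc (d.letter l),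
    letter_mul_letter_bar, one_mul, len_of_mul] at h
  omega

/-- Two consecutive letters `l`, `l'` of a reduced word conjugate a base element of order not
dividing two into the base group only if `l` is positive and `l'` is negative. -/
def IsRigid (pos : d.L → Prop) : Prop :=
  ∀ (l l' : d.L) (g w : G), w ∈ d.K l → g⁻¹ * w * g ∈ d.K (d.bar l') → w * w ≠ 1 →
    (l' = d.bar l ∧ g ∈ d.K l) ∨ (pos l ∧ ¬ pos l')

theorem mul_self_ne_one_of_conj {x : d.extension} {u v : G} (h : x * d.of u * x⁻¹ = d.of v)
    (hu : u * u ≠ 1) : v * v ≠ 1 := by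
  intro hv
  apply hu
  apply d.of_injective
  have e : d.of u = x⁻¹ * d.of v * x := by
    rw [← h]
    group
  have e2 : x⁻¹ * d.of v * x * (x⁻¹ * d.of v * x) = x⁻¹ * (d.of v * d.of v) * x := by group
  rw [map_mul, e, e2, ← map_mul, hv, map_one]
  group

variable {d} {pos : d.L → Prop}

theorem IsRigid.turn (hr : d.IsRigid pos) {l l' : d.L} {g w u : G} {z : d.extension}
    (hlen : d.len (d.letter l * (d.of g * (d.letter l' * z))) = d.len z + 2) (hw : w ∈ d.K l)
    (h : d.of g * (d.letter l' * z) * d.of u * (d.of g * (d.letter l' * z))⁻¹ = d.of w)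
    (hu : u * u ≠ 1) : pos l ∧ ¬ pos l' ∧ ∃ w' ∈ d.K l', z * d.of u * z⁻¹ = d.of w' := by
  have hl' : d.len (d.letter l' * z) = d.len z + 1 := by
    have h1 := d.len_letter_mul l (d.of g * (d.letter l' * z))
    have h2 := d.len_letter_mul l' z
    rw [len_of_mul] at h1
    omega
  obtain ⟨h2, h3⟩ := d.exists_mem_of_conj_letter_mul hl' (conj_of_conj_of_mul h)
  rcases hr l l' g w hw h2 (d.mul_self_ne_one_of_conj h hu) with h4 | h4
  · exact absurd h4 (d.not_cancels_of_len (z := z) (by omega))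
  · exact ⟨h4.1, h4.2, h3⟩

theorem IsRigid.mul_self_eq_one (hr : d.IsRigid pos) {x : d.extension} {u v : G}
    (hx : 3 ≤ d.len x) (h : x * d.of u * x⁻¹ = d.of v) : u * u = 1 := by
  by_contra hu
  obtain ⟨g₀, l, x₁, rfl, h1⟩ := d.exists_eq_of_mul_letter_mul (x := x) (by omega)
  rw [len_of_mul] at h1 hx
  obtain ⟨g₁, l₁, x₂, rfl, h2⟩ := d.exists_eq_of_mul_letter_mul (x := x₁) (by omega)
  have h2' := d.len_of_mul g₁ (d.letter l₁ * x₂)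
  obtain ⟨g₂, l₂, x₃, rfl, h3⟩ := d.exists_eq_of_mul_letter_mul (x := x₂) (by omega)
  have h3' := d.len_of_mul g₂ (d.letter l₂ * x₃)
  obtain ⟨-, w, hw, h4⟩ := d.exists_mem_of_conj_letter_mul h1.symm
    (conj_of_conj_of_mul h)
  obtain ⟨-, h5, w', hw', h6⟩ := hr.turn (by omega) hw h4 hu
  exact h5 (hr.turn (by omega) hw' h6 hu).1

/-- The centralizer of a base element that is conjugate only into positive associated subgroups
lies in the base group. -/
theorem IsRigid.len_eq_zero_of_commute (hr : d.IsRigid pos)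
    (hpos : ∀ l, pos l → ¬ pos (d.bar l)) {u : G} (hu : u * u ≠ 1)
    (hK : ∀ l g, g⁻¹ * u * g ∈ d.K l → pos l) {x : d.extension} (hx : Commute x (d.of u)) :
    d.len x = 0 := by
  by_contra h0
  obtain ⟨g, l, y, rfl, h1⟩ := d.exists_eq_of_mul_letter_mul h0
  rw [len_of_mul] at h1
  have h2 : d.letter l * y * d.of u * (d.letter l * y)⁻¹ = d.of (g⁻¹ * u * g) :=
    conj_of_conj_of_mul (by rw [hx.eq, mul_inv_cancel_right])
  obtain ⟨h4, w, hw, h5⟩ := d.exists_mem_of_conj_letter_mul h1.symm h2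
  have h6 : ¬ pos l := fun h => hpos l h (hK _ _ h4)
  by_cases hy : d.len y = 0
  · obtain ⟨g', rfl⟩ := d.len_eq_zero_iff.1 hy
    rw [← map_inv, ← map_mul, ← map_mul] at h5
    refine h6 (hK l g'⁻¹ ?_)
    rw [inv_inv, d.of_injective h5]
    exact hw
  · obtain ⟨g₁, l₁, z, rfl, h7⟩ := d.exists_eq_of_mul_letter_mul hy
    exact h6 (hr.turn (by omega) hw h5 hu).1

end Conjugation

section Involutions

variable {G : Type u} [Group G] {d : HNNData G} {pos : d.L → Prop}

theorem not_isOfFinOrder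
    (hinf : ∀ r s : G, IsInvol r → IsInvol s → r ≠ s → ¬ IsOfFinOrder (r * s))
    {r s : d.extension} (hr : IsInvol r) (hs : IsInvol s) (hne : r ≠ s) :
    ¬ IsOfFinOrder (r * s) := by
  rcases d.isTreeAction.elliptic_or_hyperbolic hr.mul_self hs.mul_self 1 with
    ⟨x, h1, h2⟩ | ⟨x, n, hn, -, h⟩
  · obtain ⟨r₀, h1⟩ := d.len_eq_zero_iff.1 h1
    obtain ⟨s₀, h2⟩ := d.len_eq_zero_iff.1 h2
    rw [smul_eq_mul, ← mul_assoc] at h1 h2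
    have hr₀ : IsInvol r₀ := (isInvol_map_iff d.of_injective).1 (h1 ▸ hr.conj x)
    have hs₀ : IsInvol s₀ := (isInvol_map_iff d.of_injective).1 (h2 ▸ hs.conj x)
    have hne₀ : r₀ ≠ s₀ := by
      rintro rfl
      rw [h1] at h2
      exact hne (by simpa using h2)
    intro hf
    refine hinf r₀ s₀ hr₀ hs₀ hne₀ ?_
    rw [← d.of_injective.isOfFinOrder_iff, map_mul, h1, h2]
    obtain ⟨n, hn, hn1⟩ := isOfFinOrder_iff_pow_eq_one.1 hf
    refine isOfFinOrder_iff_pow_eq_one.2 ⟨n, hn, ?_⟩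
    rw [← zpow_natCast, conj_mul_zpow, zpow_natCast, hn1]
    group
  · intro hf
    obtain ⟨k, hk, hk1⟩ := isOfFinOrder_iff_pow_eq_one.1 hf
    have h1 := h k
    rw [hk1, one_smul, d.isTreeAction.self] at h1
    have := Nat.mul_pos (Nat.mul_pos two_pos hn) hk
    omega

/-- Two involutions of an HNN extension are simultaneously conjugate into the base group, or
they lie in a malnormal dihedral group. -/
theorem IsRigid.conj_or_malnormal (hr : d.IsRigid pos)
    (hinf : ∀ r s : G, IsInvol r → IsInvol s → r ≠ s → ¬ IsOfFinOrder (r * s))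
    {r s : d.extension} (hri : IsInvol r) (hsi : IsInvol s) (hne : r ≠ s) :
    (∃ (x : d.extension) (r₀ s₀ : G), IsInvol r₀ ∧ IsInvol s₀ ∧ r₀ ≠ s₀ ∧
      x⁻¹ * d.of r₀ * x = r ∧ x⁻¹ * d.of s₀ * x = s) ∨
      ∃ a b : d.extension, IsMalnormalPair a b ∧ r ∈ Subgroup.closure {a, b} ∧
        s ∈ Subgroup.closure {a, b} := by
  rcases d.isTreeAction.elliptic_or_hyperbolic hri.mul_self hsi.mul_self 1 with
    ⟨x, h1, h2⟩ | ⟨x, n, hn, hx, h⟩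
  · left
    obtain ⟨r₀, h1⟩ := d.len_eq_zero_iff.1 h1
    obtain ⟨s₀, h2⟩ := d.len_eq_zero_iff.1 h2
    rw [smul_eq_mul, ← mul_assoc] at h1 h2
    refine ⟨x⁻¹, r₀, s₀, (isInvol_map_iff d.of_injective).1 (h1 ▸ hri.conj x),
      (isInvol_map_iff d.of_injective).1 (h2 ▸ hsi.conj x), ?_, eq_conj_inv h1.symm,
      eq_conj_inv h2.symm⟩
    rintro rfl
    rw [h1] at h2
    exact hne (by simpa using h2)
  · right
    refine d.isTreeAction.exists_isMalnormalPair
      (fun r s h1 h2 h3 => not_isOfFinOrder hinf h1 h2 h3)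
      (fun g x y hxy h1 h2 => ?_) hri hsi hn hx h
    obtain ⟨v, h1⟩ := d.len_eq_zero_iff.1 h1
    obtain ⟨u, h2⟩ := d.len_eq_zero_iff.1 h2
    rw [smul_eq_mul, ← mul_assoc] at h1 h2
    have h3 : u * u = 1 := hr.mul_self_eq_one hxy (v := v) (by
      rw [h1, h2]
      group)
    have e : g * g = y * (d.of u * d.of u) * y⁻¹ := by
      rw [h2]
      group
    rw [e, ← map_mul, h3, map_one]
    group

end Involutions

end HNNData

section MalnormalPairs

variable {G : Type*} [Group G] {j t a b a' b' : G}

theorem IsMalnormalPair.not_isOfFinOrder (hp : IsMalnormalPair a b)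
    (hinf : ∀ r s : G, IsInvol r → IsInvol s → r ≠ s → ¬ IsOfFinOrder (r * s)) :
    ¬ IsOfFinOrder (a * b) := hinf a b hp.left hp.right hp.ne

/-- A malnormal dihedral group is not commensurable with a conjugate of `⟨j, t⟩`. -/
theorem IsDihedralGood.conj_zpow_ne (h : IsDihedralGood j t) (hp : IsMalnormalPair a b) {g : G}
    {m n : ℤ} (hm : m ≠ 0) : g⁻¹ * (a * b) ^ m * g ≠ (j * t) ^ n := by
  intro hg
  obtain ⟨y, hy1, hy2⟩ := h.exists_conj 0 2 (by norm_num)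
  have hjj := h.left.mul_self
  have hy : y⁻¹ * (j * t) ^ n * y = (j * t) ^ (2 * n) := by
    rw [← conj_mul_zpow, hy1, hy2, zpow_zero, mul_one, ← mul_assoc, hjj, one_mul, zpow_mul]
  have hq := hp.conj g
  have hfin := hq.not_isOfFinOrder h.not_isOfFinOrder
  rw [← conj_mul_zpow] at hg
  have hg2 : (j * t) ^ (2 * n) = (g⁻¹ * a * g * (g⁻¹ * b * g)) ^ (2 * m) := by
    rw [mul_comm 2 m, mul_comm 2 n, zpow_mul _ m, hg, ← zpow_mul]
  have hmem := hq.mem_of_conj y m (2 * m) hm (by omega) (by rw [hg, hy, hg2])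
  rcases conj_zpow_of_mem_closure_pair hq.left.mul_self hq.right.mul_self hmem m with e | e <;>
  · rw [hg, hy, hg2] at e
    try rw [← hg] at e
    rw [zpow_eq_zpow_iff_of_not_isOfFinOrder hfin] at e
    omega

/-- Commensurable malnormal dihedral groups are equal. -/
theorem IsMalnormalPair.conj_mem_closure (hp : IsMalnormalPair a b) (hq : IsMalnormalPair a' b')
    {g : G} {m n : ℤ} (hn : n ≠ 0) (h : g⁻¹ * (a * b) ^ m * g = (a' * b') ^ n) {x : G}
    (hx : x ∈ Subgroup.closure {a, b}) : g⁻¹ * x * g ∈ Subgroup.closure {a', b'} := by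
  have e : (g⁻¹ * x * g)⁻¹ * (a' * b') ^ n * (g⁻¹ * x * g) =
      g⁻¹ * (x⁻¹ * (a * b) ^ m * x) * g := by
    rw [← h]
    group
  rcases conj_zpow_of_mem_closure_pair hp.left.mul_self hp.right.mul_self hx m with e' | e' <;>
    rw [e'] at e
  · exact hq.mem_of_conj _ n n hn hn (e.trans h)
  · refine hq.mem_of_conj _ n (-n) hn (neg_ne_zero.2 hn) (e.trans ?_)
    rw [zpow_neg, zpow_neg, ← h]
    group

/-- Commensurability up to conjugacy of malnormal pairs. -/
def malnormalSetoid (G : Type*) [Group G] : Setoid {p : G × G // IsMalnormalPair p.1 p.2} where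
  r p q := ∃ (g : G) (m n : ℤ), m ≠ 0 ∧ n ≠ 0 ∧
    g⁻¹ * (p.1.1 * p.1.2) ^ m * g = (q.1.1 * q.1.2) ^ n
  iseqv :=
    { refl := fun p => ⟨1, 1, 1, one_ne_zero, one_ne_zero, by simp⟩
      symm := fun ⟨g, m, n, hm, hn, h⟩ => ⟨g⁻¹, n, m, hn, hm, eq_conj_inv h⟩
      trans := fun ⟨g, m, n, hm, hn, h⟩ ⟨g', m', n', hm', hn', h'⟩ =>
        ⟨g * g', m * m', n' * n, mul_ne_zero hm hm', mul_ne_zero hn' hn, by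
          rw [← conj_conj, zpow_mul, conj_zpow_of_conj h, ← zpow_mul, mul_comm n, zpow_mul,
            conj_zpow_of_conj h', ← zpow_mul]⟩ }

/-- Commensurability classes of malnormal pairs. -/
def MalnormalClass (G : Type*) [Group G] : Type _ := Quotient (malnormalSetoid G)

namespace MalnormalClass

/-- The first involution of a representative. -/
noncomputable def fst (s : MalnormalClass G) : G := (Quotient.out s).1.1

/-- The second involution of a representative. -/
noncomputable def snd (s : MalnormalClass G) : G := (Quotient.out s).1.2

theorem isMalnormalPair (s : MalnormalClass G) : IsMalnormalPair s.fst s.snd :=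
  (Quotient.out s).2

theorem eq_of_conj {s s' : MalnormalClass G} {g : G} {m n : ℤ} (hm : m ≠ 0) (hn : n ≠ 0)
    (h : g⁻¹ * (s.fst * s.snd) ^ m * g = (s'.fst * s'.snd) ^ n) : s = s' :=
  Quotient.out_equiv_out.1 ⟨g, m, n, hm, hn, h⟩

theorem exists_conj_mem (hp : IsMalnormalPair a b) : ∃ (s : MalnormalClass G) (g : G),
    ∀ x ∈ Subgroup.closure {a, b}, g⁻¹ * x * g ∈ Subgroup.closure {s.fst, s.snd} := by
  have h := Quotient.mk_out (s := malnormalSetoid G) ⟨(a, b), hp⟩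
  obtain ⟨g, m, n, -, hn, h⟩ := (malnormalSetoid G).symm h
  exact ⟨Quotient.mk (malnormalSetoid G) ⟨(a, b), hp⟩, g, fun x hx =>
    hp.conj_mem_closure (isMalnormalPair _) hn h hx⟩

end MalnormalClass

end MalnormalPairs

namespace HNNData

/-- The HNN extension data identifying, for each `i`, the two images of `P i` under a pair of
embeddings of a group `D`. -/
noncomputable def ofEmbeddings {G : Type u} [Group G] {D : Type*} [Group D] {I : Type u}
    (P : I → Subgroup D) (α : I → Bool → D →* G) (hα : ∀ i b, Function.Injective (α i b)) :
    HNNData G where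
  L := I × Bool
  bar l := (l.1, !l.2)
  sgn l := if l.2 then 1 else -1
  K l := (P l.1).map (α l.1 l.2)
  φ l k := α l.1 (!l.2) (Function.invFun (α l.1 l.2) k)
  bar_bar l := by simp
  sgn_odd := by
    rintro ⟨i, _ | _⟩ <;> simp
  sgn_bar := by
    rintro ⟨i, _ | _⟩ <;> rfl
  φ_mem := by
    rintro ⟨i, b⟩ _ ⟨p, hp, rfl⟩
    exact ⟨p, hp, by rw [Function.leftInverse_invFun (hα i b)]⟩
  φ_mul := by
    rintro ⟨i, b⟩ _ _ ⟨p, hp, rfl⟩ ⟨q, hq, rfl⟩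
    simp only
    rw [← map_mul, Function.leftInverse_invFun (hα i b), Function.leftInverse_invFun (hα i b),
      Function.leftInverse_invFun (hα i b), map_mul]
  φ_bar := by
    rintro ⟨i, b⟩ _ ⟨p, hp, rfl⟩
    simp only [Bool.not_not]
    rw [Function.leftInverse_invFun (hα i b), Function.leftInverse_invFun (hα i !b)]

end HNNData

section Step

variable {G : Type u} [Group G] {j t : G}

namespace IsDihedralGood

/-- The first involutions of the dihedral groups identified by the stable letters. -/
noncomputable def fstInvol (j : G) : Option (MalnormalClass G) → Bool → G
  | some s, false => s.fst
  | _, _ => j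

/-- The second involutions of the dihedral groups identified by the stable letters. -/
noncomputable def sndInvol (t : G) : Option (MalnormalClass G) → Bool → G
  | some s, false => s.snd
  | _, _ => t

theorem isInvol_fstInvol (h : IsDihedralGood j t) : ∀ i b, IsInvol (fstInvol j i b)
  | some s, false => s.isMalnormalPair.left
  | some _, true => h.left
  | none, _ => h.left

theorem isInvol_sndInvol (h : IsDihedralGood j t) : ∀ i b, IsInvol (sndInvol t i b)
  | some s, false => s.isMalnormalPair.right
  | some _, true => h.right
  | none, _ => h.right

theorem fstInvol_ne_sndInvol (h : IsDihedralGood j t) : ∀ i b, fstInvol j i b ≠ sndInvol t i b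
  | some s, false => s.isMalnormalPair.ne
  | some _, true => h.ne
  | none, _ => h.ne

/-- The HNN extension that conjugates every malnormal dihedral subgroup to `⟨j, t⟩`, with one
additional free letter. -/
noncomputable def hnn (h : IsDihedralGood j t) : HNNData G :=
  HNNData.ofEmbeddings (D := DihedralGroup 0) (I := Option (MalnormalClass G))
    (fun i => i.elim ⊥ fun _ => ⊤)
    (fun i b => dihedralHom (fstInvol j i b) (sndInvol t i b) (h.isInvol_fstInvol i b).mul_self
      (h.isInvol_sndInvol i b).mul_self)
    (fun i b => dihedralHom_injective (h.isInvol_fstInvol i b) (h.isInvol_sndInvol i b)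
      (h.not_isOfFinOrder _ _ (h.isInvol_fstInvol i b) (h.isInvol_sndInvol i b)
        (h.fstInvol_ne_sndInvol i b)))

/-- The stable letters of `h.hnn`. -/
def toLetter (h : IsDihedralGood j t) (l : Option (MalnormalClass G) × Bool) : h.hnn.L := l

theorem bar_toLetter (h : IsDihedralGood j t) (i : Option (MalnormalClass G)) (b : Bool) :
    h.hnn.bar (h.toLetter (i, b)) = h.toLetter (i, !b) := rfl

theorem mem_K_true (h : IsDihedralGood j t) {s : MalnormalClass G} {g : G} :
    g ∈ h.hnn.K (h.toLetter (some s, true)) ↔ g ∈ Subgroup.closure {j, t} := by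
  rw [← range_dihedralHom j t h.left.mul_self h.right.mul_self, MonoidHom.range_eq_map]
  rfl

theorem mem_K_false (h : IsDihedralGood j t) {s : MalnormalClass G} {g : G} :
    g ∈ h.hnn.K (h.toLetter (some s, false)) ↔ g ∈ Subgroup.closure {s.fst, s.snd} := by
  rw [← range_dihedralHom s.fst s.snd s.isMalnormalPair.left.mul_self
    s.isMalnormalPair.right.mul_self, MonoidHom.range_eq_map]
  rfl

theorem mem_K_none (h : IsDihedralGood j t) {b : Bool} {g : G} :
    g ∈ h.hnn.K (h.toLetter (none, b)) ↔ g = 1 := by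
  rw [← Subgroup.mem_bot, ← Subgroup.map_bot (dihedralHom j t h.left.mul_self h.right.mul_self)]
  rfl

theorem exists_toLetter (h : IsDihedralGood j t) (l : h.hnn.L) : ∃ i b, l = h.toLetter (i, b) :=
  ⟨l.1, l.2, rfl⟩

/-- Letters conjugating `⟨j, t⟩` to a malnormal dihedral group. -/
def IsPos (h : IsDihedralGood j t) (l : h.hnn.L) : Prop := ∃ s, l = h.toLetter (some s, true)

theorem not_isPos_toLetter_false (h : IsDihedralGood j t) (i : Option (MalnormalClass G)) :
    ¬ h.IsPos (h.toLetter (i, false)) := by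
  rintro ⟨s, hs⟩
  have hb : false = true := congrArg Prod.snd hs
  exact Bool.false_ne_true hb

theorem not_isPos_bar (h : IsDihedralGood j t) (l : h.hnn.L) (hl : h.IsPos l) :
    ¬ h.IsPos (h.hnn.bar l) := by
  obtain ⟨s, rfl⟩ := hl
  exact h.not_isPos_toLetter_false _

theorem conj_mul_self_ne_one {w g : G} (hw : w * w ≠ 1) : g⁻¹ * w * g * (g⁻¹ * w * g) ≠ 1 := by
  intro h1
  apply hw
  have e : g⁻¹ * w * g * (g⁻¹ * w * g) = g⁻¹ * (w * w) * g := by group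
  rw [e] at h1
  have : w * w = g * (g⁻¹ * (w * w) * g) * g⁻¹ := by group
  rw [this, h1]
  group

theorem isRigid (h : IsDihedralGood j t) : h.hnn.IsRigid h.IsPos := by
  intro l l' g w hw hgw hww
  have hgww := conj_mul_self_ne_one (g := g) hww
  obtain ⟨i, b, rfl⟩ := h.exists_toLetter l
  obtain ⟨i', b', rfl⟩ := h.exists_toLetter l'
  rw [bar_toLetter] at hgw ⊢
  have hjj := h.left.mul_self
  have htt := h.right.mul_self
  rcases i with _ | s
  · rw [mem_K_none] at hw
    simp [hw] at hww
  rcases i' with _ | s'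
  · rw [mem_K_none] at hgw
    simp [hgw] at hgww
  have hs := s.isMalnormalPair
  have hs' := s'.isMalnormalPair
  rcases b with _ | _
  · obtain ⟨m, hm, rfl⟩ := zpow_of_mul_self_ne_one hs.left.mul_self hs.right.mul_self
      (h.mem_K_false.1 hw) hww
    rcases b' with _ | _
    · obtain ⟨n, hn, hgn⟩ := zpow_of_mul_self_ne_one hjj htt (h.mem_K_true.1 hgw) hgww
      exact absurd hgn (h.conj_zpow_ne hs hm)
    · obtain ⟨n, hn, hgn⟩ := zpow_of_mul_self_ne_one hs'.left.mul_self hs'.right.mul_self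
        (h.mem_K_false.1 hgw) hgww
      obtain rfl := MalnormalClass.eq_of_conj hm hn hgn
      exact Or.inl ⟨rfl, h.mem_K_false.2 (hs.mem_of_conj g m n hm hn hgn)⟩
  · obtain ⟨m, hm, rfl⟩ := zpow_of_mul_self_ne_one hjj htt (h.mem_K_true.1 hw) hww
    rcases b' with _ | _
    · exact Or.inr ⟨⟨s, rfl⟩, h.not_isPos_toLetter_false _⟩
    · obtain ⟨n, hn, hgn⟩ := zpow_of_mul_self_ne_one hs'.left.mul_self hs'.right.mul_self
        (h.mem_K_false.1 hgw) hgww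
      exact absurd (eq_conj_inv hgn) (h.conj_zpow_ne hs' hn)

theorem mul_mul_self_ne_one (h : IsDihedralGood j t) : j * t * (j * t) ≠ 1 := by
  intro h1
  refine h.not_isOfFinOrder j t h.left h.right h.ne
    (isOfFinOrder_iff_pow_eq_one.2 ⟨2, two_pos, by rw [sq, h1]⟩)

theorem isPos_of_conj_mem (h : IsDihedralGood j t) (l : h.hnn.L) (g : G)
    (hl : g⁻¹ * (j * t) * g ∈ h.hnn.K l) : h.IsPos l := by
  have hww := conj_mul_self_ne_one (g := g) h.mul_mul_self_ne_one
  obtain ⟨i, b, rfl⟩ := h.exists_toLetter l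
  rcases i with _ | s
  · rw [mem_K_none] at hl
    simp [hl] at hww
  rcases b with _ | _
  · obtain ⟨n, hn, hgn⟩ := zpow_of_mul_self_ne_one s.isMalnormalPair.left.mul_self
      s.isMalnormalPair.right.mul_self (h.mem_K_false.1 hl) hww
    refine absurd (eq_conj_inv hgn) ?_
    rw [← zpow_one (j * t)]
    exact h.conj_zpow_ne s.isMalnormalPair hn
  · exact ⟨s, rfl⟩

theorem len_eq_zero_of_commute (h : IsDihedralGood j t) {x : h.hnn.extension}
    (hx : Commute x (h.hnn.of (j * t))) : h.hnn.len x = 0 :=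
  h.isRigid.len_eq_zero_of_commute h.not_isPos_bar h.mul_mul_self_ne_one h.isPos_of_conj_mem hx

/-- Distinct involutions of `⟨j, t⟩` are conjugate to `(j, t)`. -/
theorem exists_conj_of_mem_closure (h : IsDihedralGood j t) {r s : G} (hr : IsInvol r)
    (hs : IsInvol s) (hne : r ≠ s) (hrD : r ∈ Subgroup.closure {j, t})
    (hsD : s ∈ Subgroup.closure {j, t}) : ∃ x : G, x⁻¹ * j * x = r ∧ x⁻¹ * t * x = s := by
  have key : ∀ {r : G}, IsInvol r → r ∈ Subgroup.closure {j, t} →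
      ∃ k : ℤ, r = j * (j * t) ^ k := by
    intro r hr hrD
    obtain ⟨k, rfl | rfl⟩ := (mem_closure_pair_iff h.left.mul_self h.right.mul_self).1 hrD
    · have h1 := hr.mul_self
      rw [← zpow_add, zpow_eq_one_iff_of_not_isOfFinOrder
        (h.not_isOfFinOrder j t h.left h.right h.ne)] at h1
      have h2 : k = 0 := by omega
      exact absurd (by rw [h2, zpow_zero]) hr.ne_one
    · exact ⟨k, rfl⟩
  obtain ⟨k, rfl⟩ := key hr hrD
  obtain ⟨l, rfl⟩ := key hs hsD
  exact h.exists_conj k l fun hkl => hne (by rw [hkl])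

/-- All pairs of distinct involutions of the base group are conjugate in the extension. -/
theorem exists_conj_of (h : IsDihedralGood j t) {r s : G} (hr : IsInvol r) (hs : IsInvol s)
    (hne : r ≠ s) : ∃ x : h.hnn.extension, x⁻¹ * h.hnn.of j * x = h.hnn.of r ∧
      x⁻¹ * h.hnn.of t * x = h.hnn.of s := by
  rcases h.conj_or_malnormal r s hr hs hne with ⟨x, rfl, rfl⟩ | ⟨a, b, hp, hra, hsa⟩
  · exact ⟨h.hnn.of x, by simp, by simp⟩
  obtain ⟨c, g, hg⟩ := MalnormalClass.exists_conj_mem hp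
  set l := h.toLetter (some c, false)
  have key : ∀ {r : G}, IsInvol r → r ∈ Subgroup.closure {a, b} →
      IsInvol (h.hnn.φ l (g⁻¹ * r * g)) ∧ h.hnn.φ l (g⁻¹ * r * g) ∈ Subgroup.closure {j, t} ∧
      h.hnn.of r = (h.hnn.letter l * h.hnn.of g⁻¹)⁻¹ * h.hnn.of (h.hnn.φ l (g⁻¹ * r * g)) *
        (h.hnn.letter l * h.hnn.of g⁻¹) := by
    intro r hr hra
    have h1 : g⁻¹ * r * g ∈ h.hnn.K l := h.mem_K_false.2 (hg r hra)
    have h2 := h.hnn.letter_mul_of l h1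
    have h3 : h.hnn.of r = (h.hnn.letter l * h.hnn.of g⁻¹)⁻¹ *
        h.hnn.of (h.hnn.φ l (g⁻¹ * r * g)) * (h.hnn.letter l * h.hnn.of g⁻¹) := by
      rw [mul_assoc, ← mul_assoc (h.hnn.of (h.hnn.φ l _)), ← h2]
      simp only [map_mul, map_inv]
      group
    refine ⟨(isInvol_map_iff h.hnn.of_injective).1 ?_, h.mem_K_true.1 (h.hnn.φ_mem _ _ h1), h3⟩
    rw [← eq_conj_inv h3.symm]
    exact (hr.map h.hnn.of_injective).conj _
  obtain ⟨hr1, hr2, hr3⟩ := key hr hra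
  obtain ⟨hs1, hs2, hs3⟩ := key hs hsa
  obtain ⟨x, hx1, hx2⟩ := h.exists_conj_of_mem_closure hr1 hs1 (by
    intro e
    rw [e, ← hs3] at hr3
    exact hne (h.hnn.of_injective hr3)) hr2 hs2
  refine ⟨h.hnn.of x * (h.hnn.letter l * h.hnn.of g⁻¹), ?_, ?_⟩
  · rw [← conj_conj, hr3, ← hx1]
    simp
  · rw [← conj_conj, hs3, ← hx2]
    simp

theorem extension (h : IsDihedralGood j t) : IsDihedralGood (h.hnn.of j) (h.hnn.of t) where
  left := h.left.map h.hnn.of_injective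
  right := h.right.map h.hnn.of_injective
  ne := h.hnn.of_injective.ne h.ne
  not_isOfFinOrder r s hr hs hne := HNNData.not_isOfFinOrder h.not_isOfFinOrder hr hs hne
  eq_one_of_commute x hj ht := by
    obtain ⟨g, rfl⟩ := h.hnn.len_eq_zero_iff.1 (h.len_eq_zero_of_commute (x := x) (by
      rw [map_mul]
      exact hj.mul_right ht))
    rw [h.eq_one_of_commute g (h.hnn.of_injective (by simpa using hj.eq))
      (h.hnn.of_injective (by simpa using ht.eq)), map_one]
  exists_conj k l hkl := by
    obtain ⟨x, h1, h2⟩ := h.exists_conj k l hkl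
    exact ⟨h.hnn.of x, by simpa using congrArg h.hnn.of h1, by simpa using congrArg h.hnn.of h2⟩
  conj_or_malnormal r s hr hs hne := by
    rcases h.isRigid.conj_or_malnormal h.not_isOfFinOrder hr hs hne with
      ⟨x, r₀, s₀, hr₀, hs₀, hne₀, rfl, rfl⟩ | hm
    · left
      obtain ⟨y, h1, h2⟩ := h.exists_conj_of hr₀ hs₀ hne₀
      exact ⟨y * x, by rw [← conj_conj, h1], by rw [← conj_conj, h2]⟩
    · exact Or.inr hm

/-- The extension contains translations that do not commute. -/
theorem exists_not_commute (h : IsDihedralGood j t) : ∃ a : h.hnn.extension, IsInvol a ∧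
    ¬ Commute (h.hnn.of j * a) (h.hnn.of (j * t)) := by
  set l := h.toLetter (none, true)
  set e := h.hnn.letter l
  refine ⟨e⁻¹⁻¹ * h.hnn.of j * e⁻¹, (h.left.map h.hnn.of_injective).conj _, fun hc => ?_⟩
  have h1 := h.len_eq_zero_of_commute hc
  rw [HNNData.len_of_mul, inv_inv, mul_assoc] at h1
  have h2 : h.hnn.len e⁻¹ = 1 := by
    rw [HNNData.len_inv, ← mul_one e, ← map_one h.hnn.of]
    exact h.hnn.len_letter_mul_of l 1
  have h3 : h.hnn.len (h.hnn.of j * e⁻¹) = 1 := by rw [HNNData.len_of_mul, h2]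
  have h4 := (h.hnn.eq_and_mem_of_len_letter_mul_lt (l := l) (l' := l) (g := j⁻¹)
    (x := h.hnn.of j * e⁻¹) (by rw [h1, h3]; exact one_pos) (by
      rw [map_inv, inv_mul_cancel_left, mul_inv_cancel, HNNData.len_one, h3]
      exact one_pos)).2
  rw [h.mem_K_none, inv_eq_one] at h4
  exact h.left.ne_one h4

end IsDihedralGood

end Step

/-! ### Free products inside an extension by a free letter -/

/-- The HNN extension data with trivial associated subgroups and one stable letter. -/
noncomputable def freeLetterData (A : Type u) [Group A] : HNNData A :=
  HNNData.ofEmbeddings (D := PUnit.{1}) (I := PUnit.{u + 1}) (fun _ => ⊤) (fun _ _ => 1)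
    fun _ _ => Function.injective_of_subsingleton _

namespace FreeLetter

variable {A : Type u} [Group A]

/-- The stable letter and its inverse. -/
noncomputable def letter (i : Bool) : (freeLetterData A).extension :=
  (freeLetterData A).letter (PUnit.unit, i)

theorem letter_not (i : Bool) : letter (A := A) (!i) = (letter i)⁻¹ :=
  (freeLetterData A).letter_bar (PUnit.unit, i)

theorem eq_one_of_mem_K {l : (freeLetterData A).L} {a : A} (h : a ∈ (freeLetterData A).K l) :
    a = 1 := by
  obtain ⟨_, _, rfl⟩ := h
  rfl

theorem isRigid (pos : (freeLetterData A).L → Prop) : (freeLetterData A).IsRigid pos := by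
  intro l l' g w hw _ hww
  rw [eq_one_of_mem_K hw, mul_one] at hww
  exact absurd rfl hww

theorem eq_one_of_conj {x : (freeLetterData A).extension} {u v : A}
    (hx : (freeLetterData A).len x ≠ 0)
    (h : x * (freeLetterData A).of u * x⁻¹ = (freeLetterData A).of v) : v = 1 := by
  obtain ⟨g, l, y, rfl, h1⟩ := (freeLetterData A).exists_eq_of_mul_letter_mul hx
  rw [HNNData.len_of_mul] at h1
  obtain ⟨h2, -⟩ := (freeLetterData A).exists_mem_of_conj_letter_mul h1.symm
    (HNNData.conj_of_conj_of_mul h)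
  have h3 := eq_one_of_mem_K h2
  have : v = g * (g⁻¹ * v * g) * g⁻¹ := by group
  rw [this, h3]
  group

theorem len_mul_letter (x : (freeLetterData A).extension) (i : Bool) :
    (freeLetterData A).len (x * letter i) = (freeLetterData A).len x + 1 ∨
      (freeLetterData A).len (x * letter i) + 1 = (freeLetterData A).len x := by
  have h := (freeLetterData A).len_letter_mul (PUnit.unit, !i) x⁻¹
  have e : letter (!i) * x⁻¹ = (x * letter i)⁻¹ := by rw [mul_inv_rev, letter_not]
  change (freeLetterData A).len (letter (!i) * x⁻¹) = _ ∨
    (freeLetterData A).len (letter (!i) * x⁻¹) + 1 = _ at h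
  rwa [e, HNNData.len_inv, HNNData.len_inv] at h

theorem eq_and_eq_one_of_len_mul_letter_lt {x : (freeLetterData A).extension} {i k : Bool} {b : A}
    (hi : (freeLetterData A).len (x * letter i) < (freeLetterData A).len x)
    (hk : (freeLetterData A).len (x * (freeLetterData A).of b * letter k) <
      (freeLetterData A).len x) : i = k ∧ b = 1 := by
  have key : ∀ (y : (freeLetterData A).extension) (i : Bool),
      (freeLetterData A).letter (PUnit.unit, !i) * y⁻¹ = (y * letter i)⁻¹ := fun y i => by
    rw [mul_inv_rev, ← letter_not]
    rfl
  obtain ⟨h1, h2⟩ := (freeLetterData A).eq_and_mem_of_len_letter_mul_lt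
    (l := (PUnit.unit, !i)) (l' := (PUnit.unit, !k)) (g := b⁻¹) (x := x⁻¹)
    (by rwa [key, HNNData.len_inv, HNNData.len_inv])
    (by rwa [map_inv, ← mul_inv_rev, key, HNNData.len_inv, HNNData.len_inv])
  exact ⟨Bool.not_inj (congrArg Prod.snd h1), inv_eq_one.1 (eq_one_of_mem_K h2)⟩

theorem len_letter (i : Bool) : (freeLetterData A).len (letter i) = 1 := by
  have h := (freeLetterData A).len_letter_mul_of (PUnit.unit, i) 1
  rwa [map_one, mul_one] at h

/-- Products of elements of `B false` and `B true` with stable letters in between, alternating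
between the letter and its inverse. Such products with `s = i = false` form the free product of
`B false` and a conjugate of `B true`. -/
inductive Path (B : Bool → Subgroup A) (s : Bool) : Bool → (freeLetterData A).extension → Prop
  | base (b : A) (hb : b ∈ B s) : Path B s s ((freeLetterData A).of b)
  | step (i : Bool) (x : (freeLetterData A).extension) (b : A) (hx : Path B s i x)
    (hlen : (freeLetterData A).len (x * letter i) = (freeLetterData A).len x + 1)
    (hb : b ∈ B (!i)) : Path B s (!i) (x * letter i * (freeLetterData A).of b)

namespace Path

variable {B : Bool → Subgroup A} {s i k : Bool} {x y : (freeLetterData A).extension}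

theorem one (B : Bool → Subgroup A) (s : Bool) : Path B s s 1 := by
  rw [← map_one (freeLetterData A).of]
  exact base 1 (one_mem _)

theorem mul_of (h : Path B s i x) {b : A} (hb : b ∈ B i) :
    Path B s i (x * (freeLetterData A).of b) := by
  cases h with
  | base c hc =>
    rw [← map_mul]
    exact base _ (mul_mem hc hb)
  | step k y c hy hlen hc =>
    rw [mul_assoc, ← map_mul]
    exact step k y _ hy hlen (mul_mem hc hb)

theorem mul_letter (h : Path B s i x) : Path B s (!i) (x * letter i) := by
  rcases len_mul_letter x i with h1 | h1
  · have := step i x 1 h h1 (one_mem _)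
    rwa [map_one, mul_one] at this
  · cases h with
    | base c hc =>
      rw [HNNData.len_of_mul, len_letter, ← mul_one ((freeLetterData A).of c), HNNData.len_of_mul,
        HNNData.len_one] at h1
      omega
    | step k y c hy hlen hc =>
      have e : y * letter k * (freeLetterData A).of c * (freeLetterData A).of c⁻¹ *
          letter (!k) = y := by
        rw [letter_not, map_inv]
        group
      rw [HNNData.len_mul_of] at h1
      obtain ⟨-, h2⟩ := eq_and_eq_one_of_len_mul_letter_lt (b := c⁻¹) (k := !k)
        (x := y * letter k * (freeLetterData A).of c) (i := !k)
        (by rw [HNNData.len_mul_of]; omega) (by rw [e, HNNData.len_mul_of]; omega)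
      rw [inv_eq_one] at h2
      subst h2
      rw [map_one, mul_one, letter_not, mul_inv_cancel_right, Bool.not_not]
      exact hy

theorem mul (h : Path B s i x) (h' : Path B i k y) : Path B s k (x * y) := by
  induction h' with
  | base b hb => exact h.mul_of hb
  | step k y b _ _ hb ih =>
    rw [← mul_assoc, ← mul_assoc]
    exact ih.mul_letter.mul_of hb

theorem inv (h : Path B s i x) : Path B i s x⁻¹ := by
  induction h with
  | base b hb =>
    rw [← map_inv]
    exact base _ (inv_mem hb)
  | step k y b _ _ hb ih =>
    rw [mul_inv_rev, mul_inv_rev, ← letter_not, ← map_inv]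
    have h1 := (one B (!k)).mul_letter
    rw [Bool.not_not, one_mul] at h1
    exact (base _ (inv_mem hb)).mul (h1.mul ih)

theorem len_of (b : A) : (freeLetterData A).len ((freeLetterData A).of b) = 0 :=
  (freeLetterData A).len_eq_zero_iff.2 ⟨b, rfl⟩

theorem exists_mem_of_len_eq_zero (h : Path B s i x) (hx : (freeLetterData A).len x = 0) :
    s = i ∧ ∃ b ∈ B s, (freeLetterData A).of b = x := by
  cases h with
  | base b hb => exact ⟨rfl, b, hb, rfl⟩
  | step k y b _ hlen _ =>
    rw [HNNData.len_mul_of] at hx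
    omega

theorem exists_mul_of_le_len (h : Path B s i x) {n : ℕ} (hn : n ≤ (freeLetterData A).len x) :
    ∃ (k : Bool) (y z : (freeLetterData A).extension), x = y * z ∧ Path B s k y ∧
      (freeLetterData A).len y = n ∧ (freeLetterData A).len z + n = (freeLetterData A).len x := by
  induction h with
  | base b hb =>
    rw [len_of, Nat.le_zero] at hn
    subst hn
    exact ⟨s, _, 1, (mul_one _).symm, base b hb, len_of b, by rw [HNNData.len_one, len_of]⟩
  | step k y b hy hlen hb ih =>
    rcases hn.eq_or_lt with rfl | hn
    · exact ⟨_, _, 1, (mul_one _).symm, step k y b hy hlen hb, rfl, by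
        rw [HNNData.len_one, zero_add]⟩
    · rw [HNNData.len_mul_of, hlen] at hn
      obtain ⟨k', y', z', rfl, h1, rfl, h2⟩ := ih (by omega)
      refine ⟨k', y', z' * letter k * (freeLetterData A).of b, by simp only [mul_assoc], h1,
        rfl, ?_⟩
      have h3 := (freeLetterData A).len_mul_le z' (letter k)
      have h4 := (freeLetterData A).len_mul_le y' (z' * letter k)
      rw [len_letter] at h3
      rw [HNNData.len_mul_of, HNNData.len_mul_of, hlen]
      rw [← mul_assoc] at h4
      omega

end Path

/-- The free product of `B false` and a conjugate of `B true`. -/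
def coprod (B : Bool → Subgroup A) : Subgroup (freeLetterData A).extension where
  carrier := {x | Path B false false x}
  mul_mem' := Path.mul
  one_mem' := Path.one B false
  inv_mem' := Path.inv

/-- The tree on which `coprod B` acts. -/
def Vertex (B : Bool → Subgroup A) : Type u :=
  {p : Bool × (freeLetterData A).extension // Path B false p.1 p.2}

noncomputable instance (B : Bool → Subgroup A) : MulAction (coprod B) (Vertex B) where
  smul g p := ⟨(p.1.1, g * p.1.2), g.2.mul p.2⟩
  one_smul _ := Subtype.ext (Prod.ext rfl (one_mul _))
  mul_smul _ _ _ := Subtype.ext (Prod.ext rfl (mul_assoc _ _ _))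

variable {B : Bool → Subgroup A}

theorem smul_snd (g : coprod B) (p : Vertex B) : (g • p).1.2 = g * p.1.2 := rfl

/-- The distance between vertices. -/
noncomputable def Vertex.dist (p q : Vertex B) : ℕ := (freeLetterData A).len (p.1.2⁻¹ * q.1.2)

theorem isTreeAction (B : Bool → Subgroup A) : IsTreeAction (coprod B) (Vertex.dist (B := B)) where
  self p := (freeLetterData A).isTreeAction.self _
  comm p q := (freeLetterData A).isTreeAction.comm _ _
  four_point p q r s := (freeLetterData A).isTreeAction.four_point _ _ _ _
  smul g p q := (freeLetterData A).isTreeAction.smul g.1 p.1.2 q.1.2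
  geodesic p q n hn := by
    obtain ⟨k, y, z, h1, h2, h3, h4⟩ := (p.2.inv.mul q.2).exists_mul_of_le_len hn
    refine ⟨⟨(k, p.1.2 * y), p.2.mul h2⟩, ?_, ?_⟩
    · change (freeLetterData A).len (p.1.2⁻¹ * (p.1.2 * y)) = n
      rw [inv_mul_cancel_left, h3]
    · change (freeLetterData A).len ((p.1.2 * y)⁻¹ * q.1.2) + n = _
      rw [mul_inv_rev, mul_assoc, h1, inv_mul_cancel_left, h4]
      rfl
  even_of_sq r p hr := (freeLetterData A).isTreeAction.even_of_sq r.1 p.1.2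
    (congrArg Subtype.val hr)

/-- The base vertices. -/
noncomputable def basePoint : Bool → (freeLetterData A).extension
  | false => 1
  | true => letter false

theorem path_basePoint (B : Bool → Subgroup A) : ∀ i, Path B false i (basePoint i)
  | false => Path.one B false
  | true => by
    have := (Path.one B false).mul_letter
    rwa [one_mul] at this

/-- The embeddings of the factors. -/
noncomputable def incl (B : Bool → Subgroup A) (i : Bool) : B i →* coprod B where
  toFun b := ⟨basePoint i * (freeLetterData A).of b * (basePoint i)⁻¹,
    ((path_basePoint B i).mul_of b.2).mul (path_basePoint B i).inv⟩
  map_one' := Subtype.ext (by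
    change basePoint i * (freeLetterData A).of 1 * (basePoint i)⁻¹ = 1
    simp)
  map_mul' b c := Subtype.ext (by
    change basePoint i * (freeLetterData A).of (b * c) * (basePoint i)⁻¹ =
      basePoint i * (freeLetterData A).of b * (basePoint i)⁻¹ *
        (basePoint i * (freeLetterData A).of c * (basePoint i)⁻¹)
    rw [map_mul]
    group)

theorem coe_incl (i : Bool) (b : B i) :
    (incl B i b : (freeLetterData A).extension) =
      basePoint i * (freeLetterData A).of b * (basePoint i)⁻¹ := rfl

theorem incl_injective (B : Bool → Subgroup A) (i : Bool) : Function.Injective (incl B i) := by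
  intro b c h
  have h1 := congrArg Subtype.val h
  rw [coe_incl, coe_incl] at h1
  exact Subtype.ext ((freeLetterData A).of_injective (mul_left_cancel (mul_right_cancel h1)))

/-- The factors are malnormal. -/
theorem exists_incl_of_conj {i : Bool} {g : coprod B} {u v : B i} (hu : u ≠ 1)
    (h : g⁻¹ * incl B i u * g = incl B i v) : ∃ b, incl B i b = g := by
  have h1 := congrArg Subtype.val h
  set e := basePoint (A := A) i with he
  set x := e⁻¹ * g.1⁻¹ * e with hx
  have hp : Path B i i x := ((path_basePoint B i).inv.mul g.2.inv).mul (path_basePoint B i)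
  have h2 : x * (freeLetterData A).of u * x⁻¹ = (freeLetterData A).of v := by
    have h3 : e⁻¹ * (g.1⁻¹ * (e * (freeLetterData A).of u * e⁻¹) * g.1) * e =
      (freeLetterData A).of v := by
      have h4 : g.1⁻¹ * (e * (freeLetterData A).of u * e⁻¹) * g.1 =
        e * (freeLetterData A).of v * e⁻¹ := h1
      rw [h4]
      group
    rw [← h3, hx]
    group
  have h0 : (freeLetterData A).len x = 0 := by
    by_contra h0
    have h3 := eq_one_of_conj h0 h2
    rw [h3, map_one, mul_inv_eq_one, mul_eq_left] at h2
    exact hu (Subtype.ext ((freeLetterData A).of_injective (h2.trans (map_one _).symm)))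
  obtain ⟨-, b, hb, hbx⟩ := hp.exists_mem_of_len_eq_zero h0
  refine ⟨⟨b, hb⟩⁻¹, Subtype.ext ?_⟩
  rw [map_inv]
  change (e * (freeLetterData A).of b * e⁻¹)⁻¹ = g.1
  rw [hbx, hx]
  group

/-- Elements fixing a vertex are conjugate into a factor. -/
theorem exists_incl_of_dist_eq_zero (p : Vertex B) : ∃ γ : coprod B, ∀ g : coprod B,
    p.dist (g • p) = 0 → ∃ b, γ⁻¹ * g * γ = incl B p.1.1 b := by
  refine ⟨⟨p.1.2 * (basePoint p.1.1)⁻¹, p.2.mul (path_basePoint B _).inv⟩, fun g hg => ?_⟩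
  have h1 : Path B p.1.1 p.1.1 (p.1.2⁻¹ * (g * p.1.2)) := p.2.inv.mul (g.2.mul p.2)
  obtain ⟨-, b, hb, h2⟩ := h1.exists_mem_of_len_eq_zero hg
  refine ⟨⟨b, hb⟩, Subtype.ext ?_⟩
  change (p.1.2 * (basePoint p.1.1)⁻¹)⁻¹ * g.1 * (p.1.2 * (basePoint p.1.1)⁻¹) =
    basePoint p.1.1 * (freeLetterData A).of b * (basePoint p.1.1)⁻¹
  rw [h2]
  group

end FreeLetter

namespace FreeLetter

section Involutions

variable {A : Type u} [Group A] {B : Bool → Subgroup A}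

/-- Two involutions of the free product are simultaneously conjugate into a factor, or their
product is hyperbolic. -/
theorem exists_incl_or_hyperbolic {r s : coprod B} (hr : IsInvol r) (hs : IsInvol s) :
    (∃ (i : Bool) (γ : coprod B) (r₀ s₀ : B i), γ⁻¹ * incl B i r₀ * γ = r ∧
      γ⁻¹ * incl B i s₀ * γ = s) ∨
      ∃ (p : Vertex B) (n : ℕ), 0 < n ∧ p.dist (r • p) = 0 ∧
        ∀ k : ℕ, p.dist ((r * s) ^ k • p) = 2 * n * k := by
  rcases (isTreeAction B).elliptic_or_hyperbolic hr.mul_self hs.mul_self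
    ⟨(false, 1), Path.one B false⟩ with ⟨p, h1, h2⟩ | h
  · obtain ⟨γ, hγ⟩ := exists_incl_of_dist_eq_zero p
    obtain ⟨r₀, h1⟩ := hγ r h1
    obtain ⟨s₀, h2⟩ := hγ s h2
    exact Or.inl ⟨_, γ⁻¹, r₀, s₀, eq_conj_inv h1, eq_conj_inv h2⟩
  · exact Or.inr h

theorem not_isOfFinOrder
    (hinf : ∀ (i : Bool) (r s : B i), IsInvol r → IsInvol s → r ≠ s → ¬ IsOfFinOrder (r * s))
    {r s : coprod B} (hr : IsInvol r) (hs : IsInvol s) (hne : r ≠ s) :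
    ¬ IsOfFinOrder (r * s) := by
  intro hf
  obtain ⟨k, hk, hk1⟩ := isOfFinOrder_iff_pow_eq_one.1 hf
  rcases exists_incl_or_hyperbolic hr hs with ⟨i, γ, r₀, s₀, rfl, rfl⟩ | ⟨p, n, hn, -, h⟩
  · rw [← zpow_natCast, conj_mul_zpow, zpow_natCast, ← map_mul, ← map_pow] at hk1
    have h1 := eq_conj_inv hk1
    rw [mul_one, inv_mul_cancel, ← map_one (incl B i)] at h1
    have hr₀ := eq_conj_inv (g := γ) (x := incl B i r₀) rfl ▸ hr.conj γ⁻¹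
    have hs₀ := eq_conj_inv (g := γ) (x := incl B i s₀) rfl ▸ hs.conj γ⁻¹
    refine hinf i r₀ s₀ ((isInvol_map_iff (incl_injective B i)).1 hr₀)
      ((isInvol_map_iff (incl_injective B i)).1 hs₀) (fun e => hne (by rw [e])) ?_
    exact isOfFinOrder_iff_pow_eq_one.2 ⟨k, hk, incl_injective B i h1.symm⟩
  · have h1 := h k
    rw [hk1, one_smul, (isTreeAction B).self] at h1
    have := Nat.mul_pos (Nat.mul_pos two_pos hn) hk
    omega

theorem conj_or_malnormal
    (hinf : ∀ (i : Bool) (r s : B i), IsInvol r → IsInvol s → r ≠ s → ¬ IsOfFinOrder (r * s))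
    {r s : coprod B} (hr : IsInvol r) (hs : IsInvol s) :
    (∃ (i : Bool) (γ : coprod B) (r₀ s₀ : B i), γ⁻¹ * incl B i r₀ * γ = r ∧
      γ⁻¹ * incl B i s₀ * γ = s) ∨
      ∃ a b : coprod B, IsMalnormalPair a b ∧ r ∈ Subgroup.closure {a, b} ∧
        s ∈ Subgroup.closure {a, b} := by
  rcases exists_incl_or_hyperbolic hr hs with h | ⟨p, n, hn, hp, h⟩
  · exact Or.inl h
  right
  refine (isTreeAction B).exists_isMalnormalPair
    (fun _ _ h1 h2 h3 => not_isOfFinOrder hinf h1 h2 h3)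
    (fun g x y hxy h1 h2 => ?_) hr hs hn hp h
  obtain ⟨v, h1⟩ := (freeLetterData A).len_eq_zero_iff.1 h1
  obtain ⟨w, h2⟩ := (freeLetterData A).len_eq_zero_iff.1 h2
  rw [smul_snd] at h1 h2
  have h3 : w * w = 1 := (isRigid fun _ => True).mul_self_eq_one hxy (v := v) (by
    rw [h1, h2]
    group)
  have e : g.1 * g.1 = y.1.2 * ((freeLetterData A).of w * (freeLetterData A).of w) * y.1.2⁻¹ := by
    rw [h2]
    group
  refine Subtype.ext (e.trans ?_)
  rw [← map_mul, h3, map_one, mul_one, mul_inv_cancel]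
  rfl

end Involutions

end FreeLetter

/-- Malnormal embeddings preserve malnormal pairs. -/
theorem IsMalnormalPair.map {M Γ : Type*} [Group M] [Group Γ] {f : M →* Γ}
    (hf : Function.Injective f)
    (hmal : ∀ (g : Γ) (u v : M), u ≠ 1 → g⁻¹ * f u * g = f v → ∃ b, f b = g) {a b : M}
    (hab : ¬ IsOfFinOrder (a * b)) (h : IsMalnormalPair a b) : IsMalnormalPair (f a) (f b) where
  left := h.left.map hf
  right := h.right.map hf
  ne := hf.ne h.ne
  mem_of_conj g m n hm hn hg := by
    rw [← map_mul, ← map_zpow, ← map_zpow] at hg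
    obtain ⟨x, rfl⟩ := hmal g _ _ (fun h1 =>
      hm ((zpow_eq_one_iff_of_not_isOfFinOrder hab).1 h1)) hg
    rw [← map_inv, ← map_mul, ← map_mul] at hg
    have h1 := Subgroup.mem_map_of_mem f (h.mem_of_conj x m n hm hn (hf hg))
    rwa [MonoidHom.map_closure, Set.image_pair] at h1

namespace FreeLetter

variable {A : Type u} [Group A] {B : Bool → Subgroup A}

theorem exists_conj_of_incl {i : Bool} (γ : coprod B) {r s : coprod B} {a b : B i}
    (h : IsMalnormalPair (incl B i a) (incl B i b)) {r₀ s₀ : B i}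
    (hr : r₀ ∈ Subgroup.closure {a, b}) (hs : s₀ ∈ Subgroup.closure {a, b})
    (hr' : γ⁻¹ * incl B i r₀ * γ = r) (hs' : γ⁻¹ * incl B i s₀ * γ = s) :
    ∃ a b : coprod B, IsMalnormalPair a b ∧ r ∈ Subgroup.closure {a, b} ∧
        s ∈ Subgroup.closure {a, b} := by
  have key : ∀ {x : B i}, x ∈ Subgroup.closure {a, b} → γ⁻¹ * incl B i x * γ ∈
      Subgroup.closure {γ⁻¹ * incl B i a * γ, γ⁻¹ * incl B i b * γ} := fun hx => by
    have h1 := Subgroup.mem_map_of_mem (incl B i) hx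
    rw [MonoidHom.map_closure, Set.image_pair] at h1
    exact conj_mem_closure_pair γ h1
  exact ⟨_, _, h.conj γ, hr' ▸ key hr, hs' ▸ key hs⟩

/-- The free product of a group in which all pairs of distinct involutions are contained in
malnormal dihedral groups with a group as in `IsDihedralGood`. -/
theorem isDihedralGood {j t : B true} (h : IsDihedralGood j t)
    (hinf : ∀ r s : B false, IsInvol r → IsInvol s → r ≠ s → ¬ IsOfFinOrder (r * s))
    (hmal : ∀ r s : B false, IsInvol r → IsInvol s → r ≠ s →
      ∃ a b : B false, IsMalnormalPair a b ∧ r ∈ Subgroup.closure {a, b} ∧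
        s ∈ Subgroup.closure {a, b}) :
    IsDihedralGood (incl B true j) (incl B true t) := by
  have hinf' : ∀ (i : Bool) (r s : B i), IsInvol r → IsInvol s → r ≠ s →
      ¬ IsOfFinOrder (r * s) := by
    rintro (_ | _)
    · exact hinf
    · exact h.not_isOfFinOrder
  have hmap : ∀ {i : Bool} {a b : B i}, IsMalnormalPair a b →
      IsMalnormalPair (incl B i a) (incl B i b) := fun {i a b} hab =>
    hab.map (incl_injective B i) (fun g u v => exists_incl_of_conj)
      (hinf' i a b hab.left hab.right hab.ne)
  refine
    { left := h.left.map (incl_injective B true)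
      right := h.right.map (incl_injective B true)
      ne := (incl_injective B true).ne h.ne
      not_isOfFinOrder := fun r s hr hs hne => not_isOfFinOrder hinf' hr hs hne
      eq_one_of_commute := fun x hj ht => ?_
      exists_conj := fun k l hkl => ?_
      conj_or_malnormal := fun r s hr hs hne => ?_ }
  · obtain ⟨b, rfl⟩ := exists_incl_of_conj (g := x) (u := j * t) (v := j * t) (fun h1 => h.ne (by
      rw [← h.right.inv_eq]
      exact eq_inv_of_mul_eq_one_left h1)) (by
        rw [map_mul, mul_assoc, ← (hj.mul_right ht).eq, inv_mul_cancel_left])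
    rw [h.eq_one_of_commute b (incl_injective B true (by simpa using hj.eq))
      (incl_injective B true (by simpa using ht.eq)), map_one]
  · obtain ⟨x, h1, h2⟩ := h.exists_conj k l hkl
    exact ⟨incl B true x, by simpa using congrArg (incl B true) h1,
      by simpa using congrArg (incl B true) h2⟩
  · rcases conj_or_malnormal hinf' hr hs with ⟨i, γ, r₀, s₀, h1, h2⟩ | hm
    · have hr₀ : IsInvol r₀ := by
        have h3 := hr.conj γ⁻¹
        rw [eq_conj_inv h1] at h3
        exact (isInvol_map_iff (incl_injective B i)).1 h3
      have hs₀ : IsInvol s₀ := by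
        have h3 := hs.conj γ⁻¹
        rw [eq_conj_inv h2] at h3
        exact (isInvol_map_iff (incl_injective B i)).1 h3
      have hne₀ : r₀ ≠ s₀ := by
        rintro rfl
        exact hne (h1.symm.trans h2)
      cases i with
      | false =>
        obtain ⟨a, b, hab, hra, hsa⟩ := hmal r₀ s₀ hr₀ hs₀ hne₀
        exact Or.inr (exists_conj_of_incl γ (hmap hab) hra hsa h1 h2)
      | true =>
        rcases h.conj_or_malnormal r₀ s₀ hr₀ hs₀ hne₀ with ⟨x, rfl, rfl⟩ | ⟨a, b, hab, hra, hsa⟩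
        · exact Or.inl ⟨incl B true x * γ, by rw [← h1, ← conj_conj]; simp,
            by rw [← h2, ← conj_conj]; simp⟩
        · exact Or.inr (exists_conj_of_incl γ (hmap hab) hra hsa h1 h2)
    · exact Or.inr hm

end FreeLetter

/-! ### Affine transformations of the rational line -/

/-- The map `x ↦ scale * x + shift`. -/
@[ext]
structure RatAffine where
  /-- The linear part. -/
  scale : ℚˣ
  /-- The translation part. -/
  shift : ℚ

namespace RatAffine

instance : Group RatAffine where
  mul x y := ⟨x.scale * y.scale, x.scale * y.shift + x.shift⟩
  one := ⟨1, 0⟩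
  inv x := ⟨x.scale⁻¹, -((x.scale⁻¹ : ℚˣ) * x.shift)⟩
  mul_assoc x y z := RatAffine.ext (mul_assoc _ _ _) (by
    change ((x.scale * y.scale : ℚˣ) : ℚ) * z.shift + (x.scale * y.shift + x.shift) =
      x.scale * (y.scale * z.shift + y.shift) + x.shift
    push_cast
    ring)
  one_mul x := RatAffine.ext (one_mul _) (by
    change ((1 : ℚˣ) : ℚ) * x.shift + 0 = x.shift
    simp)
  mul_one x := RatAffine.ext (mul_one _) (by
    change (x.scale : ℚ) * 0 + x.shift = x.shift
    simp)
  inv_mul_cancel x := RatAffine.ext (inv_mul_cancel x.scale) (by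
    change ((x.scale⁻¹ : ℚˣ) : ℚ) * x.shift + -((x.scale⁻¹ : ℚˣ) * x.shift) = 0
    ring)

theorem mul_def (x y : RatAffine) :
    x * y = ⟨x.scale * y.scale, x.scale * y.shift + x.shift⟩ := rfl

theorem one_def : (1 : RatAffine) = ⟨1, 0⟩ := rfl

theorem isInvol_mk (b : ℚ) : IsInvol (⟨-1, b⟩ : RatAffine) := by
  refine isInvol_iff.2 ⟨RatAffine.ext (by simp [mul_def, one_def]) (by simp [mul_def, one_def]),
    fun h => ?_⟩
  have h1 := congrArg (fun x => (x.scale : ℚ)) h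
  change ((-1 : ℚˣ) : ℚ) = ((1 : ℚˣ) : ℚ) at h1
  norm_num at h1

theorem exists_eq_of_isInvol {x : RatAffine} (hx : IsInvol x) : ∃ b, x = ⟨-1, b⟩ := by
  obtain ⟨h1, h2⟩ := isInvol_iff.1 hx
  obtain ⟨a, b⟩ := x
  rw [mul_def, one_def, RatAffine.ext_iff] at h1
  rcases mul_self_eq_one_iff.1 (congrArg Units.val h1.1) with h3 | h3
  · exfalso
    refine h2 (RatAffine.ext (Units.ext h3) ?_)
    have h4 := h1.2
    change (a : ℚ) * b + b = 0 at h4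
    change b = 0
    rw [h3] at h4
    linarith
  · exact ⟨b, RatAffine.ext (Units.ext h3) rfl⟩

theorem not_isOfFinOrder {r s : RatAffine} (hr : IsInvol r) (hs : IsInvol s) (hne : r ≠ s) :
    ¬ IsOfFinOrder (r * s) := by
  obtain ⟨b, rfl⟩ := exists_eq_of_isInvol hr
  obtain ⟨c, rfl⟩ := exists_eq_of_isInvol hs
  have key : ∀ k : ℕ, ((⟨-1, b⟩ * ⟨-1, c⟩ : RatAffine) ^ k).shift = k * (b - c) := by
    intro k
    induction k with
    | zero => simp [one_def]
    | succ k ih =>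
      rw [pow_succ', mul_def, ih, mul_def]
      push_cast
      ring
  intro hf
  obtain ⟨k, hk, hk1⟩ := isOfFinOrder_iff_pow_eq_one.1 hf
  have h1 := key k
  rw [hk1, one_def, eq_comm] at h1
  rcases mul_eq_zero.1 h1 with h2 | h2
  · exact hk.ne' (by exact_mod_cast h2)
  · exact hne (by rw [sub_eq_zero.1 h2])

theorem exists_conj {r s : RatAffine} (hr : IsInvol r) (hs : IsInvol s) (hne : r ≠ s) :
    ∃ x : RatAffine, x⁻¹ * ⟨-1, 0⟩ * x = r ∧ x⁻¹ * ⟨-1, 1⟩ * x = s := by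
  obtain ⟨p, rfl⟩ := exists_eq_of_isInvol hr
  obtain ⟨q, rfl⟩ := exists_eq_of_isInvol hs
  have hpq : q - p ≠ 0 := fun h => hne (by rw [sub_eq_zero.1 h])
  refine ⟨⟨(Units.mk0 _ hpq)⁻¹, -((q - p)⁻¹ * p / 2)⟩, ?_, ?_⟩ <;>
  · rw [mul_assoc, inv_mul_eq_iff_eq_mul, mul_def, mul_def]
    ext <;> simp
    field_simp
    try ring

theorem isDihedralGood : IsDihedralGood (⟨-1, 0⟩ : RatAffine) ⟨-1, 1⟩ where
  left := isInvol_mk 0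
  right := isInvol_mk 1
  ne h := by simpa using congrArg shift h
  not_isOfFinOrder _ _ := not_isOfFinOrder
  eq_one_of_commute x hj ht := by
    have h1 := congrArg shift hj.eq
    have h2 := congrArg shift ht.eq
    simp only [mul_def, Units.val_neg, Units.val_one] at h1 h2
    refine RatAffine.ext (Units.ext ?_) ?_
    · change (x.scale : ℚ) = 1
      linarith
    · change x.shift = 0
      linarith
  exists_conj k l hkl := by
    have hne : (⟨-1, 0⟩ : RatAffine) ≠ ⟨-1, 1⟩ := fun h => by simpa using congrArg shift h
    have hfin := not_isOfFinOrder (isInvol_mk 0) (isInvol_mk 1) hne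
    refine exists_conj (isInvol_mul_zpow (isInvol_mk 0) (isInvol_mk 1) hfin k)
      (isInvol_mul_zpow (isInvol_mk 0) (isInvol_mk 1) hfin l) fun h => hkl ?_
    rwa [mul_right_inj, zpow_eq_zpow_iff_of_not_isOfFinOrder hfin] at h
  conj_or_malnormal _ _ hr hs hne := Or.inl (exists_conj hr hs hne)

end RatAffine

/-! ### Existence of a starting group -/

theorem not_isOfFinOrder_mul_of_equiv {M N : Type*} [Group M] [Group N] (f : M ≃* N)
    (hinf : ∀ r s : M, IsInvol r → IsInvol s → r ≠ s → ¬ IsOfFinOrder (r * s)) (r s : N)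
    (hr : IsInvol r) (hs : IsInvol s) (hne : r ≠ s) : ¬ IsOfFinOrder (r * s) := by
  have hf : Function.Injective f.symm.toMonoidHom := f.symm.injective
  rw [← Function.Injective.isOfFinOrder_iff (f := f.symm.toMonoidHom) hf, map_mul]
  exact hinf _ _ (hr.map hf) (hs.map hf) (f.symm.injective.ne hne)

theorem exists_isMalnormalPair_of_equiv {M N : Type*} [Group M] [Group N] (f : M ≃* N)
    (hinf : ∀ r s : M, IsInvol r → IsInvol s → r ≠ s → ¬ IsOfFinOrder (r * s)) {r s : M}
    (h : ∃ a b : M, IsMalnormalPair a b ∧ r ∈ Subgroup.closure {a, b} ∧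
      s ∈ Subgroup.closure {a, b}) :
    ∃ a b : N, IsMalnormalPair a b ∧ f r ∈ Subgroup.closure {a, b} ∧
      f s ∈ Subgroup.closure {a, b} := by
  obtain ⟨a, b, hab, hr, hs⟩ := h
  have key : ∀ {x : M}, x ∈ Subgroup.closure {a, b} → f x ∈ Subgroup.closure {f a, f b} :=
    fun hx => by
      have h1 := Subgroup.mem_map_of_mem f.toMonoidHom hx
      rwa [MonoidHom.map_closure, Set.image_pair] at h1
  exact ⟨f a, f b, hab.map (f := f.toMonoidHom) f.injective (fun g _ _ _ _ => f.surjective g)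
    (hinf a b hab.left hab.right hab.ne), key hr, key hs⟩

theorem IsDihedralGood.of_equiv {M N : Type*} [Group M] [Group N] (f : M ≃* N) {j t : M}
    (h : IsDihedralGood j t) : IsDihedralGood (f j) (f t) where
  left := h.left.map (f := f.toMonoidHom) f.injective
  right := h.right.map (f := f.toMonoidHom) f.injective
  ne := f.injective.ne h.ne
  not_isOfFinOrder := not_isOfFinOrder_mul_of_equiv f h.not_isOfFinOrder
  eq_one_of_commute x hj ht := by
    obtain ⟨x, rfl⟩ := f.surjective x
    rw [h.eq_one_of_commute x (f.injective (by simpa using hj.eq))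
      (f.injective (by simpa using ht.eq)), map_one]
  exists_conj k l hkl := by
    obtain ⟨x, h1, h2⟩ := h.exists_conj k l hkl
    exact ⟨f x, by simpa using congrArg f h1, by simpa using congrArg f h2⟩
  conj_or_malnormal r s hr hs hne := by
    obtain ⟨r, rfl⟩ := f.surjective r
    obtain ⟨s, rfl⟩ := f.surjective s
    rcases h.conj_or_malnormal r s ((isInvol_map_iff (f := f.toMonoidHom) f.injective).1 hr)
      ((isInvol_map_iff (f := f.toMonoidHom) f.injective).1 hs) (fun e => hne (by rw [e])) with
      ⟨x, rfl, rfl⟩ | hm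
    · exact Or.inl ⟨f x, by simp, by simp⟩
    · exact Or.inr (exists_isMalnormalPair_of_equiv f h.not_isOfFinOrder hm)

/-- A group in which all pairs of distinct involutions are contained in malnormal dihedral groups
embeds into a group as in `IsDihedralGood`. -/
theorem exists_isDihedralGood {G : Type u} [Group G]
    (hinf : ∀ r s : G, IsInvol r → IsInvol s → r ≠ s → ¬ IsOfFinOrder (r * s))
    (hmal : ∀ r s : G, IsInvol r → IsInvol s → r ≠ s →
      ∃ a b : G, IsMalnormalPair a b ∧ r ∈ Subgroup.closure {a, b} ∧
        s ∈ Subgroup.closure {a, b}) :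
    ∃ (Γ : Type u) (_ : Group Γ) (ι : G →* Γ) (j t : Γ), Function.Injective ι ∧
      IsDihedralGood j t := by
  let B : Bool → Subgroup (G × RatAffine) := fun i =>
    i.rec (MonoidHom.inl G RatAffine).range (MonoidHom.inr G RatAffine).range
  let e : G ≃* B false := MonoidHom.ofInjective (f := MonoidHom.inl G RatAffine)
    fun _ _ h => congrArg Prod.fst h
  let e' : RatAffine ≃* B true := MonoidHom.ofInjective (f := MonoidHom.inr G RatAffine)
    fun _ _ h => congrArg Prod.snd h
  refine ⟨FreeLetter.coprod B, inferInstance, (FreeLetter.incl B false).comp e.toMonoidHom, _, _,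
    (FreeLetter.incl_injective B false).comp e.injective,
    FreeLetter.isDihedralGood (RatAffine.isDihedralGood.of_equiv e')
      (not_isOfFinOrder_mul_of_equiv e hinf) fun r s hr hs hne => ?_⟩
  obtain ⟨r, rfl⟩ := e.surjective r
  obtain ⟨s, rfl⟩ := e.surjective s
  exact exists_isMalnormalPair_of_equiv e hinf (hmal r s
    ((isInvol_map_iff (f := e.toMonoidHom) e.injective).1 hr)
    ((isInvol_map_iff (f := e.toMonoidHom) e.injective).1 hs) fun h => hne (by rw [h]))

/-! ### The limit group -/

/-- The union of an increasing sequence of groups. -/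
theorem exists_union_of_sequence (F : ℕ → Type u) [∀ n, Group (F n)] (f : ∀ n, F n →* F (n + 1))
    (hf : ∀ n, Function.Injective (f n)) :
    ∃ (L : Type u) (_ : Group L) (ι : ∀ n, F n →* L), (∀ n, Function.Injective (ι n)) ∧
      (∀ n x, ι (n + 1) (f n x) = ι n x) ∧ ∀ x y : L, ∃ n a b, ι n a = x ∧ ι n b = y := by
  let T : ∀ ⦃m n : ℕ⦄, m ≤ n → Type u := fun m n _ => F m →* F n
  let φ : ∀ m n (h : m ≤ n), T h := fun m n h =>
    Nat.leRecOn (C := fun n => F m →* F n) h (fun {k} g => (f k).comp g) (MonoidHom.id (F m))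
  have hself : ∀ m, φ m m le_rfl = MonoidHom.id (F m) := fun m => Nat.leRecOn_self _
  have hsucc : ∀ m n (h : m ≤ n) (h' : m ≤ n + 1), φ m (n + 1) h' = (f n).comp (φ m n h) :=
    fun m n h h' => Nat.leRecOn_succ h _
  let : ∀ m n (h : m ≤ n), FunLike (T h) (F m) (F n) := fun m n _ =>
    inferInstanceAs (FunLike (F m →* F n) (F m) (F n))
  have : ∀ m n (h : m ≤ n), MonoidHomClass (T h) (F m) (F n) := fun m n _ =>
    inferInstanceAs (MonoidHomClass (F m →* F n) (F m) (F n))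
  have : DirectedSystem F (φ · · ·) :=
    { map_self := fun m x => DFunLike.congr_fun (hself m) x
      map_map := fun k m n hnm hmk x => by
        induction hmk with
        | refl => exact DFunLike.congr_fun (hself m) _
        | step h ih =>
          have h1 := DFunLike.congr_fun (hsucc m _ h (Nat.le_succ_of_le h)) (φ n m hnm x)
          have h2 := DFunLike.congr_fun
            (hsucc n _ (hnm.trans h) (hnm.trans (Nat.le_succ_of_le h))) x
          exact h1.trans ((congrArg (f _) ih).trans h2.symm) }
  have hinj : ∀ m n (h : m ≤ n), Function.Injective (φ m n h) := fun m n h => by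
    induction h with
    | refl =>
      intro x y hxy
      have h1 := DFunLike.congr_fun (hself m)
      exact (h1 x).symm.trans (hxy.trans (h1 y))
    | step h ih =>
      intro x y hxy
      have h1 := DFunLike.congr_fun (hsucc m _ h (Nat.le_succ_of_le h))
      exact ih (hf _ ((h1 x).symm.trans (hxy.trans (h1 y))))
  refine ⟨DirectLimit F φ, inferInstance, fun n =>
    { toFun := fun x => ⟦⟨n, x⟩⟧
      map_one' := (DirectLimit.one_def n).symm
      map_mul' := fun x y => (DirectLimit.mul_def n x y).symm },
    fun n => DirectLimit.mk_injective φ hinj n, fun n x => ?_, fun x y => ?_⟩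
  · have h1 := DirectLimit.mk_apply (f := φ) n (n + 1) x n.le_succ
    refine Eq.trans (congrArg (fun y => (⟦⟨n + 1, y⟩⟧ : DirectLimit F φ)) ?_) h1
    have h2 := DFunLike.congr_fun (hsucc n n le_rfl n.le_succ) x
    have h3 := DFunLike.congr_fun (hself n) x
    exact ((h2.trans (congrArg (f n) h3))).symm
  · obtain ⟨n, a, b, rfl, rfl⟩ := DirectLimit.exists_eq_mk₂ φ x y
    exact ⟨n, a, b, rfl, rfl⟩

section SharplyTwoTransitive

variable {L : Type*} [Group L] {j t : L}

theorem existsUnique_conj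
    (hconj : ∀ r s : L, IsInvol r → IsInvol s → r ≠ s → ∃ x, x⁻¹ * j * x = r ∧ x⁻¹ * t * x = s)
    (hcomm : ∀ x : L, Commute x j → Commute x t → x = 1) {a b c d : L} (ha : IsInvol a)
    (hb : IsInvol b) (hc : IsInvol c) (hd : IsInvol d) (hab : a ≠ b) (hcd : c ≠ d) :
    ∃! g : L, g⁻¹ * a * g = c ∧ g⁻¹ * b * g = d := by
  obtain ⟨x, rfl, rfl⟩ := hconj a b ha hb hab
  obtain ⟨y, rfl, rfl⟩ := hconj c d hc hd hcd
  refine ⟨x⁻¹ * y, ⟨by group, by group⟩, fun g ⟨h1, h2⟩ => ?_⟩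
  have key : ∀ z, g⁻¹ * (x⁻¹ * z * x) * g = y⁻¹ * z * y → Commute (x * g * y⁻¹) z := fun z hz => by
    have e : z * (x * g * y⁻¹) = x * g * (g⁻¹ * (x⁻¹ * z * x) * g) * y⁻¹ := by group
    refine Eq.symm (e.trans ?_)
    rw [hz]
    group
  have h3 := hcomm _ (key j h1) (key t h2)
  rw [mul_inv_eq_one] at h3
  rw [← h3, inv_mul_cancel_left]

/-- Translations of a nontrivial abelian normal subgroup would include all translations. -/
theorem eq_bot_of_normal_of_comm
    (hconj : ∀ r s : L, IsInvol r → IsInvol s → r ≠ s → ∃ x, x⁻¹ * j * x = r ∧ x⁻¹ * t * x = s)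
    (hcomm : ∀ x : L, Commute x j → Commute x t → x = 1) (hj : IsInvol j) (ht : IsInvol t)
    (hjt : j ≠ t) {a : L} (ha : IsInvol a) (hja : ¬ Commute (j * a) (j * t)) (N : Subgroup L)
    (hN : N.Normal) (hNc : ∀ x ∈ N, ∀ y ∈ N, x * y = y * x) : N = ⊥ := by
  rw [Subgroup.eq_bot_iff_forall]
  intro x hx
  by_contra hx1
  obtain ⟨r, hr, hxr⟩ : ∃ r, IsInvol r ∧ ¬ Commute x r := by
    by_contra! h
    exact hx1 (hcomm x (h j hj) (h t ht))
  have hne : x⁻¹ * r * x ≠ r := fun h => hxr (by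
    have e : r * x = x * (x⁻¹ * r * x) := by group
    exact Eq.symm (e.trans (by rw [h])))
  have hmem : x⁻¹ * r * x * r ∈ N := by
    have h1 := mul_mem (inv_mem hx) (hN.conj_mem x hx r)
    rw [hr.inv_eq] at h1
    simpa only [mul_assoc] using h1
  have hall : ∀ c, IsInvol c → j ≠ c → j * c ∈ N := by
    intro c hc hjc
    obtain ⟨g, ⟨h1, h2⟩, -⟩ := existsUnique_conj hconj hcomm (hr.conj x) hr hj hc hne hjc
    have h3 := hN.conj_mem _ hmem g⁻¹
    rw [inv_inv] at h3
    have e : j * c = g⁻¹ * (x⁻¹ * r * x * r) * g := by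
      calc j * c = g⁻¹ * (x⁻¹ * r * x) * g * (g⁻¹ * r * g) := by rw [h1, h2]
        _ = _ := by group
    rwa [e]
  refine hja (hNc _ (hall a ha ?_) _ (hall t ht hjt))
  rintro rfl
  rw [hj.mul_self] at hja
  exact hja (Commute.one_left _)

end SharplyTwoTransitive

/-- A group with a pair of involutions as in `IsDihedralGood`. -/
structure DihedralGoodGroup : Type (u + 1) where
  /-- The underlying group. -/
  carrier : Type u
  /-- The group structure. -/
  [group : Group carrier]
  /-- The first involution. -/
  fst : carrier
  /-- The second involution. -/
  snd : carrier
  isDihedralGood : IsDihedralGood fst snd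

namespace DihedralGoodGroup

instance (M : DihedralGoodGroup.{u}) : Group M.carrier := M.group

/-- The sequence of iterated HNN extensions. -/
noncomputable def tower (M : DihedralGoodGroup.{u}) : ℕ → DihedralGoodGroup.{u}
  | 0 => M
  | n + 1 => ⟨_, _, _, (tower M n).isDihedralGood.extension⟩

/-- The inclusions between successive HNN extensions. -/
noncomputable def towerMap (M : DihedralGoodGroup.{u}) (n : ℕ) :
    (M.tower n).carrier →* (M.tower (n + 1)).carrier :=
  (M.tower n).isDihedralGood.hnn.of

theorem towerMap_injective (M : DihedralGoodGroup.{u}) (n : ℕ) :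
    Function.Injective (M.towerMap n) :=
  (M.tower n).isDihedralGood.hnn.of_injective

end DihedralGoodGroup

theorem IsDihedralGood.exists_sharply_two_transitive {G : Type u} [Group G] {j t : G}
    (h : IsDihedralGood j t) :
    ∃ (L : Type u) (_ : Group L) (ι : G →* L), Function.Injective ι ∧
      (∀ r s : L, IsInvol r → IsInvol s → r ≠ s → ¬ IsOfFinOrder (r * s)) ∧
      (∀ a b c d : L, IsInvol a → IsInvol b → IsInvol c → IsInvol d → a ≠ b → c ≠ d →
        ∃! g : L, g⁻¹ * a * g = c ∧ g⁻¹ * b * g = d) ∧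
      ∀ N : Subgroup L, N.Normal → (∀ x ∈ N, ∀ y ∈ N, x * y = y * x) → N = ⊥ := by
  let M : DihedralGoodGroup.{u} := ⟨G, j, t, h⟩
  obtain ⟨L, _, ι, hι, hcompat, hsurj⟩ :=
    exists_union_of_sequence (fun n => (M.tower n).carrier) M.towerMap M.towerMap_injective
  have hfst : ∀ n, ι n (M.tower n).fst = ι 0 j := fun n => by
    induction n with
    | zero => rfl
    | succ n ih => exact (hcompat n _).trans ih
  have hsnd : ∀ n, ι n (M.tower n).snd = ι 0 t := fun n => by
    induction n with
    | zero => rfl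
    | succ n ih => exact (hcompat n _).trans ih
  have hconj : ∀ r s : L, IsInvol r → IsInvol s → r ≠ s →
      ∃ x, x⁻¹ * ι 0 j * x = r ∧ x⁻¹ * ι 0 t * x = s := by
    intro r s hr hs hne
    obtain ⟨n, a, b, rfl, rfl⟩ := hsurj r s
    obtain ⟨(x : (M.tower (n + 1)).carrier), h1, h2⟩ := (M.tower n).isDihedralGood.exists_conj_of
      ((isInvol_map_iff (hι n)).1 hr) ((isInvol_map_iff (hι n)).1 hs) (fun e => hne (by rw [e]))
    have h1' : ι (n + 1) (x⁻¹ * M.towerMap n (M.tower n).fst * x) = ι (n + 1) (M.towerMap n a) :=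
      congrArg (ι (n + 1)) h1
    have h2' : ι (n + 1) (x⁻¹ * M.towerMap n (M.tower n).snd * x) = ι (n + 1) (M.towerMap n b) :=
      congrArg (ι (n + 1)) h2
    rw [map_mul, map_mul, map_inv, hcompat, hcompat, hfst] at h1'
    rw [map_mul, map_mul, map_inv, hcompat, hcompat, hsnd] at h2'
    exact ⟨_, h1', h2'⟩
  have hcomm : ∀ x : L, Commute x (ι 0 j) → Commute x (ι 0 t) → x = 1 := by
    intro x hj ht
    obtain ⟨n, a, -, rfl, -⟩ := hsurj x 1
    rw [← hfst n] at hj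
    rw [← hsnd n] at ht
    rw [(M.tower n).isDihedralGood.eq_one_of_commute a (hι n (by simpa using hj.eq))
      (hι n (by simpa using ht.eq)), map_one]
  obtain ⟨a, ha, haj⟩ := h.exists_not_commute
  refine ⟨L, inferInstance, ι 0, hι 0, fun r s hr hs hne => ?_,
    fun a b c d ha hb hc hd => existsUnique_conj hconj hcomm ha hb hc hd,
    eq_bot_of_normal_of_comm hconj hcomm (h.left.map (hι 0)) (h.right.map (hι 0))
      ((hι 0).ne h.ne) (IsInvol.map (hι 1) ha) fun hc => haj (hι 1 ?_)⟩
  · obtain ⟨n, a, b, rfl, rfl⟩ := hsurj r s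
    rw [← map_mul, (hι n).isOfFinOrder_iff]
    exact (M.tower n).isDihedralGood.not_isOfFinOrder a b ((isInvol_map_iff (hι n)).1 hr)
      ((isInvol_map_iff (hι n)).1 hs) fun e => hne (by rw [e])
  · have e : ∀ x : G, ι 0 x = ι 1 (h.hnn.of x) := fun x => (hcompat 0 x).symm
    let f : h.hnn.extension →* L := ι 1
    have h1 : f (h.hnn.of j) * f a * (f (h.hnn.of j) * f (h.hnn.of t)) =
        f (h.hnn.of j) * f (h.hnn.of t) * (f (h.hnn.of j) * f a) := by
      have h2 := hc.eq
      rwa [e, e] at h2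
    change f _ = f _
    simpa only [map_mul] using h1

/-- under the standing hypotheses, `G` embeds into a group `𝒢` that acts
sharply 2-transitively by conjugation on its involutions in characteristic 0 and has no
nontrivial abelian normal subgroup. -/
theorem embeds_in_sharply_two_transitive_char_zero {G : Type u} [Group G] (j t t' : G)
    (H : StandingHyp j t t') :
    ∃ (𝒢 : Type u) (_ : Group 𝒢) (ι : G →* 𝒢), Function.Injective ι ∧
      (∀ r s : 𝒢, IsInvol r → IsInvol s → r ≠ s → ¬ IsOfFinOrder (r * s)) ∧
      (∀ a b c d : 𝒢, IsInvol a → IsInvol b → IsInvol c → IsInvol d → a ≠ b → c ≠ d →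
        ∃! g : 𝒢, g⁻¹ * a * g = c ∧ g⁻¹ * b * g = d) ∧
      (∀ N : Subgroup 𝒢, N.Normal → (∀ x ∈ N, ∀ y ∈ N, x * y = y * x) → N = ⊥) := by
  by_cases hjt : j = t
  · obtain ⟨Γ, _, ι, j₀, t₀, hι, h⟩ := exists_isDihedralGood H.infinite_order
      fun r s hr hs hne => (H.conj_or_malnormal hr hs hne).resolve_left (by
        rintro ⟨x, rfl, rfl⟩
        exact hne (by rw [hjt]))
    obtain ⟨L, _, κ, hκ, h1, h2, h3⟩ := h.exists_sharply_two_transitive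
    exact ⟨L, inferInstance, κ.comp ι, hκ.comp hι, h1, h2, h3⟩
  · exact (H.isDihedralGood hjt).exists_sharply_two_transitive
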